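/- (Null series.) For each i ∈ S, the series D_i^{−1} Σ_{n≥0} ( Φ_n(z_i)/⟨Φ_n,Φ_n⟩ ) φ_n converges to the zero function in the mean-square sense with weight r: the partial sums s_N(z) = D_i^{−1} Σ_{n=0}^{N} ( Φ_n(z_i)/⟨Φ_n,Φ_n⟩ ) φ_n(z) satisfy ∫_{z₁}^{z₂} |s_N(z)|² r(z) dz → 0 as N → ∞. -/

import Mathlib

open MeasureTheory Filter Topology

noncomputable section

/-- Data of a Sturm–Liouville problem with (possibly) eigenvalue-dependent
boundary conditions on `[z1, z2]`. -/
structure SLP where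
  z1 : ℝ
  z2 : ℝ
  hz : z1 < z2
  p : ℝ → ℝ
  q : ℝ → ℝ
  r : ℝ → ℝ
  a : Fin 2 → ℝ
  b : Fin 2 → ℝ
  c : Fin 2 → ℝ
  d : Fin 2 → ℝ
  hp : ContDiff ℝ 2 p
  hr : ContDiff ℝ 2 r
  hq : Continuous q
  hppos : ∀ z ∈ Set.Icc z1 z2, 0 < p z
  hrpos : ∀ z ∈ Set.Icc z1 z2, 0 < r z
  hab : ∀ j : Fin 2, (a j, b j) ≠ (0, 0)

namespace SLP

variable (P : SLP)

/-- The two boundary points: `zb 0 = z1`, `zb 1 = z2`. -/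
def zb : Fin 2 → ℝ := ![P.z1, P.z2]

/-- The sign `(−1)^{j+1}` (for the boundary labelled `j+1`, here `j : Fin 2`). -/
def sgn (_P : SLP) (j : Fin 2) : ℝ := (-1 : ℝ) ^ (j : ℕ)

/-- `j ∈ S`: the boundary condition at `zb j` is λ-dependent. -/
def inS (j : Fin 2) : Prop := (P.c j, P.d j) ≠ (0, 0)

instance (j : Fin 2) : Decidable (P.inS j) := by unfold inS; infer_instance

/-- The set `S` of λ-dependent boundaries, as a finset. -/
def Sfin : Finset (Fin 2) := Finset.univ.filter fun j => P.inS j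

/-- The boundary parameter `D_j = (−1)^{j+1}(a_j d_j − b_j c_j)`. -/
def D (j : Fin 2) : ℝ := P.sgn j * (P.a j * P.d j - P.b j * P.c j)

/-- `B_j φ = a_j φ(z_j) − b_j p(z_j) φ′(z_j)`. -/
def Bop (j : Fin 2) (φ : ℝ → ℂ) : ℂ :=
  (P.a j : ℂ) * φ (P.zb j) - (P.b j : ℂ) * ((P.p (P.zb j) : ℂ) * deriv φ (P.zb j))

/-- `C_j φ = c_j φ(z_j) − d_j p(z_j) φ′(z_j)`. -/
def Cop (j : Fin 2) (φ : ℝ → ℂ) : ℂ :=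
  (P.c j : ℂ) * φ (P.zb j) - (P.d j : ℂ) * ((P.p (P.zb j) : ℂ) * deriv φ (P.zb j))

/-- The function `Φ` associated to `φ`: equal to `φ` away from λ-dependent
boundary points, and equal to `C_j φ` at `zb j` for `j ∈ S`. -/
def assoc (φ : ℝ → ℂ) : ℝ → ℂ := fun z =>
  if P.inS 0 ∧ z = P.zb 0 then P.Cop 0 φ
  else if P.inS 1 ∧ z = P.zb 1 then P.Cop 1 φ
  else φ z

/-- The (possibly indefinite) inner product
`⟨F,G⟩ = ∫ conj(F) G r dz + Σ_{j∈S} D_j⁻¹ conj(F(z_j)) G(z_j)`. -/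
def inp (F G : ℝ → ℂ) : ℂ :=
  (∫ z in P.z1..P.z2, (starRingEnd ℂ) (F z) * G z * (P.r z : ℂ)) +
    ∑ j ∈ P.Sfin, ((P.D j : ℂ))⁻¹ * (starRingEnd ℂ) (F (P.zb j)) * G (P.zb j)

/-- `(λ, φ)` is an eigenpair of the problem. -/
def IsEigenpair (lam : ℂ) (φ : ℝ → ℂ) : Prop :=
  ContDiff ℝ 2 φ ∧
  (∃ z ∈ Set.Icc P.z1 P.z2, φ z ≠ 0) ∧
  (∀ z ∈ Set.Ioo P.z1 P.z2,
    -(deriv (fun w => (P.p w : ℂ) * deriv φ w) z) + (P.q z : ℂ) * φ z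
      = lam * ((P.r z : ℂ) * φ z)) ∧
  (∀ j : Fin 2, -(P.Bop j φ) = lam * P.Cop j φ)

/-- `λ` is an eigenvalue of the problem. -/
def IsEigenvalue (lam : ℂ) : Prop := ∃ φ, P.IsEigenpair lam φ

/-- Right-definiteness: `D_j > 0` for every `j ∈ S` (together with `r > 0`,
which is part of the standing assumptions). -/
def RightDefinite : Prop := ∀ j : Fin 2, P.inS j → 0 < P.D j

/-- Left-definiteness sign conditions. -/
def LeftDefinite : Prop :=
  (∀ z ∈ Set.Icc P.z1 P.z2, 0 ≤ P.q z) ∧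
  (∀ j : Fin 2, P.inS j →
    P.a j * P.c j / P.D j ≤ 0 ∧ P.b j * P.d j / P.D j ≤ 0 ∧
      0 ≤ (-P.sgn j) * (P.a j * P.d j) / P.D j) ∧
  (∀ j : Fin 2, ¬ P.inS j → P.b j = 0 ∨ 0 ≤ P.sgn j * P.a j / P.b j)

/-- The measure `μ = r(z) dz + Σ_{j∈S} D_j⁻¹ δ_{z_j}` on `[z1,z2]`
(right-definite case, where `D_j > 0`). -/
def muM : Measure ℝ :=
  (volume.restrict (Set.Icc P.z1 P.z2)).withDensity (fun z => ENNReal.ofReal (P.r z)) +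
    ∑ j ∈ P.Sfin, (ENNReal.ofReal (P.D j)⁻¹) • Measure.dirac (P.zb j)

/-- The positive measure `μ̃ = r(z) dz + Σ_{j∈S} |D_j|⁻¹ δ_{z_j}` on `[z1,z2]`. -/
def muAbs : Measure ℝ :=
  (volume.restrict (Set.Icc P.z1 P.z2)).withDensity (fun z => ENNReal.ofReal (P.r z)) +
    ∑ j ∈ P.Sfin, (ENNReal.ofReal |P.D j|⁻¹) • Measure.dirac (P.zb j)

/-- The weighted interior measure `r(z) dz` on `[z1,z2]`. -/
def muInt : Measure ℝ :=
  (volume.restrict (Set.Icc P.z1 P.z2)).withDensity (fun z => ENNReal.ofReal (P.r z))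

end SLP

section CompactPencil

variable {H : Type*} [NormedAddCommGroup H] [InnerProductSpace ℂ H]

local notation "⟪" x ", " y "⟫" => inner ℂ x y

/-- If every eigenvector of a `G`-symmetric operator in a finite-dimensional invariant subspace is
`G`-positive, then the form induced by `G` is positive definite on that subspace. -/
theorem re_inner_pos_of_forall_eigenvector_pos {G T : H →ₗ[ℂ] H} (hG : G.IsSymmetric)
    (hGT : ∀ x y, ⟪T x, G y⟫ = ⟪x, G (T y)⟫) :
    ∀ (n : ℕ) (V : Submodule ℂ H) [FiniteDimensional ℂ V], Module.finrank ℂ V = n →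
      (∀ x ∈ V, T x ∈ V) →
      (∀ x ∈ V, x ≠ 0 → ∀ μ : ℂ, T x = μ • x → 0 < (⟪x, G x⟫).re) →
      ∀ x ∈ V, x ≠ 0 → 0 < (⟪x, G x⟫).re := by
  intro n
  induction n using Nat.strong_induction_on with
  | _ n ih =>
  intro V _ hn hV hpos x hx hx0
  have : Nontrivial V := ⟨⟨⟨x, hx⟩, 0, fun h => hx0 (congrArg Subtype.val h)⟩⟩
  obtain ⟨μ, hμ⟩ := Module.End.exists_eigenvalue (T.restrict hV)
  obtain ⟨⟨e, heV⟩, he⟩ := hμ.exists_hasEigenvector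
  have he0 : e ≠ 0 := fun h => he.2 (Subtype.ext h)
  have heT : T e = μ • e := congrArg Subtype.val he.apply_eq_smul
  have hepos := hpos e heV he0 μ heT
  have hGe : ∀ y, ⟪y, G e⟫ = (starRingEnd ℂ) ⟪e, G y⟫ := fun y => by
    rw [inner_conj_symm]; exact (hG y e).symm
  have hee : ⟪e, G e⟫ ≠ 0 := fun h => by simp [h] at hepos
  let ℓ : H →ₗ[ℂ] ℂ := (innerSL ℂ e).toLinearMap ∘ₗ G
  have hℓ : ∀ y, ℓ y = ⟪e, G y⟫ := fun y => rfl
  let W : Submodule ℂ H := V ⊓ LinearMap.ker ℓ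
  have hW : ∀ y, y ∈ W ↔ y ∈ V ∧ ⟪e, G y⟫ = 0 := fun y => by
    simp [W, hℓ]
  have hlt : W < V := lt_of_le_of_ne inf_le_left fun h => hee ((hW e).1 (h ▸ heV)).2
  have hfin : FiniteDimensional ℂ W := Submodule.finiteDimensional_of_le hlt.le
  have key := ih _ (hn ▸ Submodule.finrank_lt_finrank_of_lt hlt) W rfl
    (fun y hy => (hW _).2 ⟨hV y ((hW y).1 hy).1, by
      rw [← hGT, heT, inner_smul_left, ((hW y).1 hy).2, mul_zero]⟩)
    (fun y hy => hpos y ((hW y).1 hy).1)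
  set c : ℂ := ⟪e, G x⟫ / ⟪e, G e⟫ with hc
  have hcx : ⟪e, G x⟫ = c * ⟪e, G e⟫ := by rw [hc]; field_simp
  have hyW : x - c • e ∈ W := (hW _).2 ⟨V.sub_mem hx (V.smul_mem _ heV), by
    rw [map_sub, map_smul, inner_sub_right, inner_smul_right, hcx, sub_self]⟩
  have hey := ((hW _).1 hyW).2
  have hexp : ⟪x, G x⟫ = ⟪x - c • e, G (x - c • e)⟫ + (Complex.normSq c : ℂ) * ⟪e, G e⟫ := by
    obtain ⟨y, hy⟩ : ∃ y, y = x - c • e := ⟨_, rfl⟩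
    rw [← hy] at hey ⊢
    rw [show x = y + c • e by simp [hy], map_add, inner_add_left, inner_add_right,
      inner_add_right, map_smul, inner_smul_left, inner_smul_right, inner_smul_left,
      inner_smul_right, hey, hGe, hey, Complex.normSq_eq_conj_mul_self]
    simp; ring
  rw [hexp, Complex.add_re, Complex.re_ofReal_mul]
  by_cases hy : x - c • e = 0
  · have hc0 : c ≠ 0 := fun h => hx0 (by simpa [h] using hy)
    rw [hy]; simpa using mul_pos (Complex.normSq_pos.2 hc0) hepos
  · exact add_pos_of_pos_of_nonneg (key _ hyW hy)
      (mul_nonneg (Complex.normSq_nonneg _) hepos.le)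

/-- A compact symmetric operator is a norm limit of symmetric operators of finite rank. -/
theorem IsCompactOperator.exists_finite_rank_symmetric [CompleteSpace H] {K : H →L[ℂ] H}
    (hK : IsCompactOperator K) (hs : (K : H →ₗ[ℂ] H).IsSymmetric) {ε : ℝ} (hε : 0 < ε) :
    ∃ K' : H →L[ℂ] H, (K' : H →ₗ[ℂ] H).IsSymmetric ∧
      FiniteDimensional ℂ (LinearMap.range (K' : H →ₗ[ℂ] H)) ∧ ‖K - K'‖ ≤ ε := by
  have hcpt := (isCompactOperator_iff_isCompact_closure_image_closedBall (K : H →ₗ[ℂ] H)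
    (one_pos)).1 hK
  obtain ⟨t, -, htf, ht⟩ := hcpt.finite_cover_balls (half_pos hε)
  let V : Submodule ℂ H := Submodule.span ℂ t
  have : FiniteDimensional ℂ V := FiniteDimensional.span_of_finite ℂ htf
  let P : H →L[ℂ] H := V.starProjection
  have hPs : IsSelfAdjoint P := isSelfAdjoint_starProjection V
  have hKs : IsSelfAdjoint K := ContinuousLinearMap.isSelfAdjoint_iff_isSymmetric.2 hs
  have h1 : ‖K - P * K‖ ≤ ε / 2 := by
    refine ContinuousLinearMap.opNorm_le_of_unit_norm (𝕜 := ℂ) (half_pos hε).le fun x hx => ?_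
    obtain ⟨y, hy, hxy⟩ := Set.mem_iUnion₂.1 (ht (subset_closure
      (Set.mem_image_of_mem _ (mem_closedBall_zero_iff.2 hx.le))))
    rw [mem_ball_iff_norm] at hxy
    refine le_trans ?_ hxy.le
    change ‖K x - V.starProjection (K x)‖ ≤ ‖K x - y‖
    rw [Submodule.starProjection_minimal]
    exact ciInf_le ⟨0, by rintro _ ⟨z, rfl⟩; positivity⟩
      (⟨y, Submodule.subset_span hy⟩ : V)
  have h2 : ‖K - K * P‖ ≤ ε / 2 := by
    have : star (K - P * K) = K - K * P := by
      rw [star_sub, star_mul, hKs.star_eq, hPs.star_eq]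
    rw [← this, norm_star]; exact h1
  have hPn : ‖P‖ ≤ 1 := Submodule.starProjection_norm_le V
  refine ⟨P * K * P, ?_, ?_, ?_⟩
  · rw [← ContinuousLinearMap.isSelfAdjoint_iff_isSymmetric, isSelfAdjoint_iff]
    simp [hKs.star_eq, hPs.star_eq, mul_assoc]
  · refine Submodule.finiteDimensional_of_le (S₂ := V) ?_
    rintro _ ⟨x, rfl⟩
    exact Submodule.starProjection_apply_mem V _
  · have : K - P * K * P = (K - P * K) + P * (K - K * P) := by
      simp [mul_sub, mul_assoc]
    rw [this]
    calc _ ≤ ‖K - P * K‖ + ‖P‖ * ‖K - K * P‖ :=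
          (norm_add_le _ _).trans (by gcongr; exact norm_mul_le _ _)
      _ ≤ ε / 2 + 1 * (ε / 2) := by gcongr
      _ = ε := by ring

/-- A positive invertible operator has an invertible self-adjoint square root. -/
theorem ContinuousLinearMap.IsPositive.exists_isUnit_sqrt [CompleteSpace H] {G : H →L[ℂ] H}
    (hG : G.IsPositive) (hu : IsUnit G) :
    ∃ S : H →L[ℂ] H, IsSelfAdjoint S ∧ IsUnit S ∧ S * S = G := by
  have h0 : 0 ≤ G := (ContinuousLinearMap.nonneg_iff_isPositive G).2 hG
  have hS : CFC.sqrt G * CFC.sqrt G = G := CFC.sqrt_mul_sqrt_self G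
  refine ⟨CFC.sqrt G, (CFC.sqrt_nonneg G).isSelfAdjoint, ?_, hS⟩
  rw [← hS] at hu
  exact ((Commute.refl (CFC.sqrt G)).isUnit_mul_iff.1 hu).1

/-- Images of a bounded sequence under a compact operator have a convergent subsequence. -/
theorem IsCompactOperator.exists_tendsto_subseq {T : H →L[ℂ] H} (hT : IsCompactOperator T)
    {x : ℕ → H} (hx : ∀ n, ‖x n‖ = 1) :
    ∃ (y : H) (k : ℕ → ℕ), StrictMono k ∧ Tendsto (fun n => T (x (k n))) atTop (𝓝 y) := by
  obtain ⟨C, hC, hsub⟩ := IsCompactOperator.image_closedBall_subset_compact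
    (f := (T : H →ₗ[ℂ] H)) hT 1
  obtain ⟨y, -, k, hk, hy⟩ := hC.tendsto_subseq (x := fun n => T (x n)) fun n =>
    hsub ⟨x n, by simp [hx], rfl⟩
  exact ⟨y, k, hk, hy⟩

/-- Approximate unit eigenvectors on which the form induced by `G` is nonpositive produce an
eigenvector. -/
theorem exists_eigenvector_of_approximate {G T : H →L[ℂ] H}
    (hG : (G : H →ₗ[ℂ] H).IsSymmetric)
    (hGc : IsCompactOperator (1 - G : H →L[ℂ] H)) (hT : IsCompactOperator T)
    (hGT : ∀ x y, ⟪T x, G y⟫ = ⟪x, G (T y)⟫) (hd : DenseRange (G * T))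
    {x : ℕ → H} {μ : ℕ → ℂ} (hx : ∀ n, ‖x n‖ = 1) (hxG : ∀ n, (⟪x n, G (x n)⟫).re ≤ 0)
    (hlim : Tendsto (fun n => T (x n) - μ n • x n) atTop (𝓝 0)) :
    ∃ (ν : ℂ) (y : H), y ≠ 0 ∧ T y = ν • y := by
  obtain ⟨y, k, hk, hy⟩ := hT.exists_tendsto_subseq hx
  obtain ⟨w, l, hl, hw⟩ := hGc.exists_tendsto_subseq (x := fun n => x (k n)) fun n => hx _
  have hμb : ∃ R, ∀ n, ‖μ n‖ ≤ R := by
    obtain ⟨C, hC⟩ := hlim.norm.bddAbove_range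
    refine ⟨‖T‖ + C, fun n => ?_⟩
    have h1 : μ n • x n = T (x n) - (T (x n) - μ n • x n) := by abel
    calc ‖μ n‖ = ‖μ n • x n‖ := by rw [norm_smul, hx, mul_one]
      _ ≤ ‖T (x n)‖ + ‖T (x n) - μ n • x n‖ := by
          conv_lhs => rw [h1]
          exact norm_sub_le _ _
      _ ≤ ‖T‖ + C := add_le_add (by simpa [hx] using T.le_opNorm (x n)) (hC ⟨n, rfl⟩)
  obtain ⟨R, hR⟩ := hμb
  obtain ⟨ν, -, m, hm, hν⟩ := (isCompact_closedBall (0 : ℂ) R).tendsto_subseq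
    (x := fun n => μ (k (l n))) fun n => by simpa using hR _
  let u : ℕ → ℕ := fun n => k (l (m n))
  have hu : StrictMono u := hk.comp (hl.comp hm)
  have hTu : Tendsto (fun n => T (x (u n))) atTop (𝓝 y) :=
    hy.comp (hl.comp hm).tendsto_atTop
  have hFu : Tendsto (fun n => (1 - G : H →L[ℂ] H) (x (u n))) atTop (𝓝 w) :=
    hw.comp hm.tendsto_atTop
  have hμu : Tendsto (fun n => μ (u n)) atTop (𝓝 ν) := hν
  have hμx : Tendsto (fun n => μ (u n) • x (u n)) atTop (𝓝 y) := by
    simpa using hTu.sub (hlim.comp hu.tendsto_atTop)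
  by_cases hν0 : ν = 0
  · exfalso
    have hT0 : Tendsto (fun n => T (x (u n))) atTop (𝓝 0) := by
      have : y = 0 := by
        refine norm_eq_zero.1 (tendsto_nhds_unique hμx.norm ?_)
        simpa [norm_smul, hx, hν0] using hμu.norm
      rwa [this] at hTu
    have hweak : ∀ z, Tendsto (fun n => ⟪x (u n), z⟫) atTop (𝓝 0) := by
      intro z
      rw [Metric.tendsto_atTop]
      intro ε hε
      obtain ⟨_, hg, g, rfl⟩ := Metric.dense_iff.1 hd z (ε / 2) (half_pos hε)
      have h1 : Tendsto (fun n => ⟪T (x (u n)), G g⟫) atTop (𝓝 0) := by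
        simpa using hT0.inner (tendsto_const_nhds (x := G g))
      obtain ⟨N, hN⟩ := Metric.tendsto_atTop.1 h1 (ε / 2) (half_pos hε)
      refine ⟨N, fun n hn => ?_⟩
      have h2 := hN n hn
      rw [hGT] at h2
      rw [dist_zero_right] at h2 ⊢
      have h3 : ⟪x (u n), z⟫ = ⟪x (u n), z - (G * T) g⟫ + ⟪x (u n), G (T g)⟫ := by
        rw [inner_sub_right]; simp
      rw [h3]
      have h4 : ‖⟪x (u n), z - (G * T) g⟫‖ < ε / 2 := by
        refine (norm_inner_le_norm _ _).trans_lt ?_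
        rw [hx, one_mul, ← dist_eq_norm, dist_comm]
        exact hg
      calc _ ≤ _ := norm_add_le _ _
        _ < ε / 2 + ε / 2 := add_lt_add h4 h2
        _ = ε := add_halves ε
    have hw0 : w = 0 := by
      have h1 : Tendsto (fun n => ⟪(1 - G : H →L[ℂ] H) (x (u n)), w⟫) atTop (𝓝 ⟪w, w⟫) :=
        hFu.inner tendsto_const_nhds
      have h2 : ∀ n, ⟪(1 - G : H →L[ℂ] H) (x (u n)), w⟫
          = ⟪x (u n), (1 - G : H →L[ℂ] H) w⟫ := fun n => by
        simp only [sub_apply, one_apply_eq_self, inner_sub_left,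
          inner_sub_right]
        congr 1
        exact hG _ _
      simp only [h2] at h1
      exact inner_self_eq_zero.1 (tendsto_nhds_unique h1 (hweak _))
    have h5 : ∀ n, 1 ≤ ‖(1 - G : H →L[ℂ] H) (x (u n))‖ := fun n => by
      have h6 : (⟪x (u n), (1 - G : H →L[ℂ] H) (x (u n))⟫).re
          = 1 - (⟪x (u n), G (x (u n))⟫).re := by
        simp [inner_self_eq_norm_sq_to_K, hx]
      have h7 := (Complex.re_le_norm _).trans
        (norm_inner_le_norm (𝕜 := ℂ) (x (u n)) ((1 - G : H →L[ℂ] H) (x (u n))))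
      rw [hx, one_mul, h6] at h7
      linarith [hxG (u n)]
    have := ge_of_tendsto' hFu.norm h5
    simp [hw0] at this
    linarith
  · have hxu : Tendsto (fun n => x (u n)) atTop (𝓝 (ν⁻¹ • y)) := by
      refine (hμu.inv₀ hν0).smul hμx |>.congr' ?_
      filter_upwards [hμu.eventually_ne hν0] with n hn
      rw [inv_smul_smul₀ hn]
    refine ⟨ν, ν⁻¹ • y, fun h => ?_, ?_⟩
    · have h1 : Tendsto (fun n => ‖x (u n)‖) atTop (𝓝 1) := by simp [hx]
      have := tendsto_nhds_unique hxu.norm h1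
      simp [h] at this
    · rw [smul_inv_smul₀ hν0]
      exact tendsto_nhds_unique ((T.continuous.tendsto _).comp hxu) hTu

/-- A compact injective operator on a nontrivial Hilbert space that is symmetric for the
(possibly indefinite) form induced by a finite rank perturbation `G` of the identity has an
eigenvector. -/
theorem exists_eigenvector_of_compact_symmetric [CompleteSpace H] [Nontrivial H]
    {G T : H →L[ℂ] H} (hG : IsSelfAdjoint G)
    (hGf : FiniteDimensional ℂ (LinearMap.range ((1 - G : H →L[ℂ] H) : H →ₗ[ℂ] H)))
    (hGc : IsCompactOperator (1 - G : H →L[ℂ] H))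
    (hT : IsCompactOperator T) (hTi : ∀ x, T x = 0 → x = 0)
    (hGT : ∀ x y, ⟪T x, G y⟫ = ⟪x, G (T y)⟫) :
    ∃ (μ : ℂ) (x : H), x ≠ 0 ∧ T x = μ • x := by
  have hGs : (G : H →ₗ[ℂ] H).IsSymmetric := ContinuousLinearMap.isSelfAdjoint_iff_isSymmetric.1 hG
  have hGs' : ∀ x y, ⟪G x, y⟫ = ⟪x, G y⟫ := hGs
  rcases hGc.hasEigenvalue_or_mem_resolventSet one_ne_zero with h | hu
  · let V : Submodule ℂ H := LinearMap.ker (G : H →ₗ[ℂ] H)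
    have hVm : ∀ x, x ∈ V ↔ G x = 0 := fun x => LinearMap.mem_ker
    have hV : ∀ x ∈ V, T x ∈ V := fun x hx => by
      rw [hVm]
      refine ext_inner_left ℂ fun y => ?_
      rw [← hGT, (hVm x).1 hx, inner_zero_right, inner_zero_right]
    have hle : V ≤ LinearMap.range ((1 - G : H →L[ℂ] H) : H →ₗ[ℂ] H) := fun x hx =>
      ⟨x, by simp [(hVm x).1 hx]⟩
    have : FiniteDimensional ℂ V := Submodule.finiteDimensional_of_le hle
    obtain ⟨x, hx⟩ := h.exists_hasEigenvector
    have hxV : G x = 0 := by simpa using hx.apply_eq_smul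
    have : Nontrivial V := ⟨⟨⟨x, hxV⟩, 0, fun h => hx.2 (congrArg Subtype.val h)⟩⟩
    obtain ⟨μ, hμ⟩ := Module.End.exists_eigenvalue ((T : H →ₗ[ℂ] H).restrict hV)
    obtain ⟨⟨e, heV⟩, he⟩ := hμ.exists_hasEigenvector
    exact ⟨μ, e, fun h => he.2 (Subtype.ext h), congrArg Subtype.val he.apply_eq_smul⟩
  have hu : IsUnit G := by simpa [resolventSet, spectrum.mem_resolventSet_iff] using hu
  by_cases hpos : ∀ x, 0 ≤ (⟪x, G x⟫).re
  · have hGp : G.IsPositive := by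
      refine ContinuousLinearMap.isPositive_def.2 ⟨hGs, fun x => ?_⟩
      rw [ContinuousLinearMap.reApplyInnerSelf, hGs']
      exact hpos x
    obtain ⟨S, hS, ⟨U, rfl⟩, hSS⟩ := hGp.exists_isUnit_sqrt hu
    have hSs : ∀ x y, ⟪(U : H →L[ℂ] H) x, y⟫ = ⟪x, (U : H →L[ℂ] H) y⟫ :=
      ContinuousLinearMap.isSelfAdjoint_iff_isSymmetric.1 hS
    have hUi : ∀ x, (U : H →L[ℂ] H) (((U⁻¹ : (H →L[ℂ] H)ˣ) : H →L[ℂ] H) x) = x := fun x =>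
      DFunLike.congr_fun U.mul_inv x
    have hiU : ∀ x, ((U⁻¹ : (H →L[ℂ] H)ˣ) : H →L[ℂ] H) ((U : H →L[ℂ] H) x) = x := fun x =>
      DFunLike.congr_fun U.inv_mul x
    have hGU : ∀ x, G x = (U : H →L[ℂ] H) ((U : H →L[ℂ] H) x) := fun x => by
      rw [← hSS]; rfl
    let M : H →L[ℂ] H := U * T * (U⁻¹ : (H →L[ℂ] H)ˣ)
    have hMx : ∀ x, M x = (U : H →L[ℂ] H) (T (((U⁻¹ : (H →L[ℂ] H)ˣ) : H →L[ℂ] H) x)) := fun x => rfl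
    have hMc : IsCompactOperator M := (hT.clm_comp (U : H →L[ℂ] H)).comp_clm _
    have hMs : (M : H →ₗ[ℂ] H).IsSymmetric := fun x y => by
      change ⟪M x, y⟫ = ⟪x, M y⟫
      have h1 : y = (U : H →L[ℂ] H) (((U⁻¹ : (H →L[ℂ] H)ˣ) : H →L[ℂ] H) y) := (hUi y).symm
      have h2 : x = (U : H →L[ℂ] H) (((U⁻¹ : (H →L[ℂ] H)ˣ) : H →L[ℂ] H) x) := (hUi x).symm
      conv_lhs => rw [hMx, hSs, h1, ← hGU, hGT, hGU, ← hSs, ← h2]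
      rw [hMx]
    have hM0 : M ≠ 0 := fun h => by
      obtain ⟨x, hx⟩ := exists_ne (0 : H)
      have h1 := hMx ((U : H →L[ℂ] H) x)
      rw [h, hiU, zero_apply] at h1
      have h2 := hiU (T x)
      rw [← h1, map_zero] at h2
      exact hx (hTi x h2.symm)
    obtain ⟨μ, hμ⟩ : ∃ μ, Module.End.HasEigenvalue (M : H →ₗ[ℂ] H) μ := by
      by_contra! h
      exact hM0 ((ContinuousLinearMap.eq_zero_of_forall_hasEigenvalue_eq_zero hMc hMs).1
        fun μ hμ => (h μ hμ).elim)
    obtain ⟨y, hy⟩ := hμ.exists_hasEigenvector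
    have hyM : M y = μ • y := hy.apply_eq_smul
    refine ⟨μ, ((U⁻¹ : (H →L[ℂ] H)ˣ) : H →L[ℂ] H) y, fun h => hy.2 ?_, ?_⟩
    · rw [← hUi y, h, map_zero]
    · rw [← hiU (T _), ← hMx, hyM, map_smul]
  push Not at hpos
  obtain ⟨x₀, hx₀⟩ := hpos
  obtain ⟨U, rfl⟩ := hu
  have hK : IsCompactOperator ((U : H →L[ℂ] H) * T) := hT.clm_comp _
  have hKs : (((U : H →L[ℂ] H) * T : H →L[ℂ] H) : H →ₗ[ℂ] H).IsSymmetric := fun x y => by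
    change ⟪(U : H →L[ℂ] H) (T x), y⟫ = ⟪x, (U : H →L[ℂ] H) (T y)⟫
    rw [hGs', hGT]
  have hKi : ∀ x, ((U : H →L[ℂ] H) * T) x = 0 → x = 0 := fun x hx => hTi x <| by
    refine (DFunLike.congr_fun U.inv_mul (T x)).symm.trans ?_
    change ((U⁻¹ : (H →L[ℂ] H)ˣ) : H →L[ℂ] H) (((U : H →L[ℂ] H) * T) x) = 0
    rw [hx, map_zero]
  have hd : DenseRange ((U : H →L[ℂ] H) * T) := by
    have h1 : (LinearMap.range (((U : H →L[ℂ] H) * T : H →L[ℂ] H) : H →ₗ[ℂ] H))ᗮ = ⊥ := by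
      refine (Submodule.eq_bot_iff _).2 fun x hx => hKi x ?_
      refine ext_inner_left ℂ fun y => ?_
      rw [inner_zero_right, ← (Submodule.mem_orthogonal _ _).1 hx _ ⟨y, rfl⟩]
      exact (hKs y x).symm
    rw [← Submodule.topologicalClosure_eq_top_iff] at h1
    rw [DenseRange, dense_iff_closure_eq]
    exact congrArg SetLike.coe h1
  have key : ∀ n : ℕ, ∃ (x : H) (μ : ℂ), ‖x‖ = 1 ∧ (⟪x, (U : H →L[ℂ] H) x⟫).re ≤ 0 ∧
      ‖T x - μ • x‖ ≤ ‖((U⁻¹ : (H →L[ℂ] H)ˣ) : H →L[ℂ] H)‖ * (1 / (n + 1)) := by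
    intro n
    obtain ⟨K', hK's, hK'f, hK'n⟩ :=
      hK.exists_finite_rank_symmetric hKs (ε := 1 / ((n : ℝ) + 1)) (by positivity)
    let T' : H →L[ℂ] H := ((U⁻¹ : (H →L[ℂ] H)ˣ) : H →L[ℂ] H) * K'
    have hUT' : ∀ x, (U : H →L[ℂ] H) (T' x) = K' x := fun x =>
      DFunLike.congr_fun U.mul_inv (K' x)
    have hfr : FiniteDimensional ℂ (LinearMap.range (T' : H →ₗ[ℂ] H)) := by
      have : LinearMap.range (T' : H →ₗ[ℂ] H) = (LinearMap.range (K' : H →ₗ[ℂ] H)).map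
          (((U⁻¹ : (H →L[ℂ] H)ˣ) : H →L[ℂ] H) : H →ₗ[ℂ] H) := LinearMap.range_comp _ _
      rw [this]; infer_instance
    let V : Submodule ℂ H := LinearMap.range (T' : H →ₗ[ℂ] H) ⊔ Submodule.span ℂ {x₀}
    have hVT : ∀ x ∈ V, T' x ∈ V := fun x _ => Submodule.mem_sup_left ⟨x, rfl⟩
    have hx₀V : x₀ ∈ V := Submodule.mem_sup_right (Submodule.mem_span_singleton_self x₀)
    obtain ⟨x, -, hx0, μ, hμ, hxG⟩ : ∃ x ∈ V, x ≠ 0 ∧ ∃ μ : ℂ, T' x = μ • x ∧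
        (⟪x, (U : H →L[ℂ] H) x⟫).re ≤ 0 := by
      by_contra! h
      have := re_inner_pos_of_forall_eigenvector_pos (G := ((U : H →L[ℂ] H) : H →ₗ[ℂ] H))
        (T := (T' : H →ₗ[ℂ] H)) hGs (fun x y => by
          change ⟪T' x, (U : H →L[ℂ] H) y⟫ = ⟪x, (U : H →L[ℂ] H) (T' y)⟫
          rw [← hGs', hUT', hUT']; exact hK's x y) _ V rfl hVT h x₀ hx₀V
          (fun h => by simp [h] at hx₀)
      exact lt_asymm hx₀ this
    have hxn : ‖x‖ ≠ 0 := norm_ne_zero_iff.2 hx0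
    have hn1 : ‖(‖x‖⁻¹ : ℂ) • x‖ = 1 := by
      rw [norm_smul]; simp [hxn]
    refine ⟨(‖x‖⁻¹ : ℂ) • x, μ, hn1, ?_, ?_⟩
    · have : ⟪(‖x‖⁻¹ : ℂ) • x, (U : H →L[ℂ] H) ((‖x‖⁻¹ : ℂ) • x)⟫
          = ((‖x‖⁻¹ * ‖x‖⁻¹ : ℝ) : ℂ) * ⟪x, (U : H →L[ℂ] H) x⟫ := by
        rw [map_smul, inner_smul_left, inner_smul_right, map_inv₀, Complex.conj_ofReal]
        push_cast; ring
      rw [this, Complex.re_ofReal_mul]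
      exact mul_nonpos_of_nonneg_of_nonpos (by positivity) hxG
    · have h1 : μ • (‖x‖⁻¹ : ℂ) • x = T' ((‖x‖⁻¹ : ℂ) • x) := by
        rw [map_smul, hμ, smul_comm]
      have h2 : ∀ z, T z - T' z = ((U⁻¹ : (H →L[ℂ] H)ˣ) : H →L[ℂ] H)
          (((U : H →L[ℂ] H) * T - K') z) := fun z => by
        rw [sub_apply, map_sub]
        congr 1
        exact (DFunLike.congr_fun U.inv_mul (T z)).symm
      rw [h1, h2]
      refine (ContinuousLinearMap.le_opNorm _ _).trans ?_
      gcongr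
      refine (ContinuousLinearMap.le_opNorm _ _).trans ?_
      rw [hn1, mul_one]
      exact hK'n
  choose x μ hx hxG hlim using key
  refine exists_eigenvector_of_approximate hGs hGc hT hGT hd hx hxG (μ := μ) ?_
  refine squeeze_zero_norm hlim ?_
  simpa using tendsto_one_div_add_atTop_nhds_zero_nat.const_mul
    ‖((U⁻¹ : (H →L[ℂ] H)ˣ) : H →L[ℂ] H)‖

/-- A bounded operator of finite rank is compact. -/
theorem ContinuousLinearMap.isCompactOperator_of_finiteDimensional_range (F : H →L[ℂ] H)
    [FiniteDimensional ℂ (LinearMap.range (F : H →ₗ[ℂ] H))] : IsCompactOperator F := by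
  let F' := F.codRestrict (LinearMap.range (F : H →ₗ[ℂ] H)) fun x =>
    LinearMap.mem_range_self (F : H →ₗ[ℂ] H) x
  have : LocallyCompactSpace (LinearMap.range (F : H →ₗ[ℂ] H)) :=
    have := FiniteDimensional.proper ℂ (LinearMap.range (F : H →ₗ[ℂ] H))
    inferInstance
  have hF' : IsCompactOperator F' := isCompactOperator_of_locallyCompactSpace_dom F'
  exact hF'.clm_comp (Submodule.subtypeL _)

/-- A system of eigenvectors of a compact operator that is symmetric for the form induced by `G`
is total as soon as no eigenvector is orthogonal to all its members. -/
theorem eq_zero_of_forall_inner_eq_zero [CompleteSpace H] {G T : H →L[ℂ] H}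
    (hG : IsSelfAdjoint G)
    (hGf : FiniteDimensional ℂ (LinearMap.range ((1 - G : H →L[ℂ] H) : H →ₗ[ℂ] H)))
    (hT : IsCompactOperator T) (hTi : ∀ x, T x = 0 → x = 0)
    (hGT : ∀ x y, ⟪T x, G y⟫ = ⟪x, G (T y)⟫) {Φ : ℕ → H} {ν : ℕ → ℂ}
    (hΦ : ∀ n, T (Φ n) = ν n • Φ n)
    (hall : ∀ (μ : ℂ) (x : H), x ≠ 0 → T x = μ • x → ∃ n, ⟪Φ n, G x⟫ ≠ 0)
    {x : H} (hx : ∀ n, ⟪Φ n, G x⟫ = 0) : x = 0 := by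
  have hGs' : ∀ x y, ⟪G x, y⟫ = ⟪x, G y⟫ := ContinuousLinearMap.isSelfAdjoint_iff_isSymmetric.1 hG
  let N : Submodule ℂ H := (Submodule.span ℂ (Set.range fun n => G (Φ n)))ᗮ
  have hN : ∀ y, y ∈ N ↔ ∀ n, ⟪Φ n, G y⟫ = 0 := fun y => by
    rw [Submodule.mem_orthogonal]
    refine ⟨fun h n => by rw [← hGs']; exact h _ (Submodule.subset_span ⟨n, rfl⟩), fun h u hu => ?_⟩
    induction hu using Submodule.span_induction with
    | mem u hu => obtain ⟨n, rfl⟩ := hu; rw [hGs', h]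
    | zero => exact inner_zero_left _
    | add u v _ _ hu hv => rw [inner_add_left, hu, hv, add_zero]
    | smul c u _ hu => rw [inner_smul_left, hu, mul_zero]
  have hNT : ∀ y : N, T y ∈ N := fun y => (hN _).2 fun n => by
    rw [← hGT, hΦ, inner_smul_left, (hN _).1 y.2, mul_zero]
  have : CompleteSpace N := (Submodule.isClosed_orthogonal _).completeSpace_coe
  let TN : N →L[ℂ] N := (T.comp N.subtypeL).codRestrict N hNT
  let GN : N →L[ℂ] N := N.orthogonalProjectionOnto.comp (G.comp N.subtypeL)
  have hGN : ∀ y z : N, ⟪y, GN z⟫ = ⟪(y : H), G z⟫ := fun y z =>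
    Submodule.inner_orthogonalProjectionOnto_eq_of_mem_left y (G z)
  have h1 : (1 - GN : N →L[ℂ] N)
      = N.orthogonalProjectionOnto.comp ((1 - G : H →L[ℂ] H).comp N.subtypeL) := by
    ext y
    simp [GN]
  by_contra hx0
  have : Nontrivial N := ⟨⟨⟨x, (hN x).2 hx⟩, 0, fun h => hx0 (congrArg Subtype.val h)⟩⟩
  have hfin : FiniteDimensional ℂ (LinearMap.range ((1 - GN : N →L[ℂ] N) : N →ₗ[ℂ] N)) := by
    refine Submodule.finiteDimensional_of_le (S₂ := (LinearMap.range
      ((1 - G : H →L[ℂ] H) : H →ₗ[ℂ] H)).map (N.orthogonalProjectionOnto : H →ₗ[ℂ] N)) ?_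
    rw [h1]
    rintro _ ⟨y, rfl⟩
    exact ⟨_, ⟨y, rfl⟩, rfl⟩
  obtain ⟨μ, y, hy0, hy⟩ := exists_eigenvector_of_compact_symmetric (H := N) (G := GN) (T := TN)
    (ContinuousLinearMap.isSelfAdjoint_iff_isSymmetric.2 fun y z => by
      change ⟪GN y, z⟫ = ⟪y, GN z⟫
      rw [← inner_conj_symm, hGN, hGN, inner_conj_symm, hGs'])
    hfin (ContinuousLinearMap.isCompactOperator_of_finiteDimensional_range _)
    ((hT.comp_clm N.subtypeL).codRestrict hNT (Submodule.isClosed_orthogonal _))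
    (fun y h => Subtype.ext (hTi y (congrArg Subtype.val h)))
    (fun y z => by rw [hGN, hGN]; exact hGT y z)
  obtain ⟨n, hn⟩ := hall μ y (fun h => hy0 (Subtype.ext h)) (congrArg Subtype.val hy)
  exact hn ((hN _).1 y.2 n)

theorem inner_sum_smul_of_orthogonal {ι : Type*} {G : H →L[ℂ] H} {Φ : ι → H} {ε : ι → ℝ}
    (ho : ∀ m n, m ≠ n → ⟪Φ m, G (Φ n)⟫ = 0) (hε : ∀ n, ⟪Φ n, G (Φ n)⟫ = ε n)
    (s : Finset ι) (c : ι → ℂ) :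
    ⟪∑ n ∈ s, c n • Φ n, G (∑ n ∈ s, c n • Φ n)⟫
      = ((∑ n ∈ s, ε n * Complex.normSq (c n) : ℝ) : ℂ) := by
  rw [map_sum, sum_inner]
  push_cast
  refine Finset.sum_congr rfl fun m hm => ?_
  rw [inner_sum, Finset.sum_eq_single m]
  · rw [map_smul, inner_smul_left, inner_smul_right, hε, Complex.normSq_eq_conj_mul_self]; ring
  · intro n _ hn
    rw [map_smul, inner_smul_left, inner_smul_right, ho m n hn.symm]; simp
  · exact fun h => (h hm).elim

/-- A system that is orthogonal for an indefinite form induced by a finite rank perturbation of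
the identity contains only finitely many negative vectors. -/
theorem finite_setOf_neg {ι : Type*} {G : H →L[ℂ] H}
    (hGf : FiniteDimensional ℂ (LinearMap.range ((1 - G : H →L[ℂ] H) : H →ₗ[ℂ] H)))
    {Φ : ι → H} {ε : ι → ℝ} (ho : ∀ m n, m ≠ n → ⟪Φ m, G (Φ n)⟫ = 0)
    (hε : ∀ n, ⟪Φ n, G (Φ n)⟫ = ε n) : {n | ε n < 0}.Finite := by
  let v : {n | ε n < 0} → LinearMap.range ((1 - G : H →L[ℂ] H) : H →ₗ[ℂ] H) := fun n =>
    ⟨(1 - G : H →L[ℂ] H) (Φ n), ⟨_, rfl⟩⟩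
  have hv : LinearIndependent ℂ v := by
    rw [linearIndependent_iff']
    intro s c hc i hi
    let x : H := ∑ n ∈ s, c n • Φ n
    have hFx : (1 - G : H →L[ℂ] H) x = 0 := by
      have := congrArg (Submodule.subtype _) hc
      rw [map_sum, map_zero] at this
      rw [← this, map_sum]
      exact Finset.sum_congr rfl fun n _ => by rw [map_smul, map_smul]; rfl
    have hGx : G x = x := by
      rw [sub_apply, sub_eq_zero] at hFx
      exact hFx.symm
    have h1 := inner_sum_smul_of_orthogonal (Φ := fun n : {n | ε n < 0} => Φ n)
      (ε := fun n => ε n) (fun m n h => ho m n (Subtype.coe_ne_coe.2 h)) (fun n => hε n) s c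
    change ⟪x, G x⟫ = _ at h1
    rw [hGx] at h1
    have h3 : ∀ n ∈ s, ε n * Complex.normSq (c n) ≤ 0 := fun n _ =>
      mul_nonpos_of_nonpos_of_nonneg (le_of_lt n.2) (Complex.normSq_nonneg _)
    have h4 : ∑ n ∈ s, ε n * Complex.normSq (c n) = 0 := by
      refine le_antisymm (Finset.sum_nonpos h3) ?_
      have := inner_self_nonneg (𝕜 := ℂ) (x := x)
      rw [h1] at this
      simpa using this
    have h5 := (Finset.sum_eq_zero_iff_of_nonpos h3).1 h4 i hi
    simpa [(show ε i < 0 from i.2).ne] using h5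
  exact hv.finite_of_isNoetherian

/-- Expansion theorem: a total system that is orthonormal for the indefinite form induced by a
finite rank perturbation `G` of the identity yields norm convergent expansions. -/
theorem tendsto_sum_inner_smul [CompleteSpace H] {G : H →L[ℂ] H} (hG : IsSelfAdjoint G)
    (hGf : FiniteDimensional ℂ (LinearMap.range ((1 - G : H →L[ℂ] H) : H →ₗ[ℂ] H)))
    {Φ : ℕ → H} {ε : ℕ → ℝ} (ho : ∀ m n, m ≠ n → ⟪Φ m, G (Φ n)⟫ = 0)
    (hε : ∀ n, ⟪Φ n, G (Φ n)⟫ = ε n) (hε1 : ∀ n, ε n = 1 ∨ ε n = -1)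
    (htot : ∀ x, (∀ n, ⟪Φ n, G x⟫ = 0) → x = 0) (f : H) :
    Tendsto (fun N : ℕ => ∑ n ∈ Finset.range N, ((ε n : ℂ) * ⟪Φ n, G f⟫) • Φ n) atTop (𝓝 f) := by
  have hGs : ∀ x y, ⟪G x, y⟫ = ⟪x, G y⟫ := ContinuousLinearMap.isSelfAdjoint_iff_isSymmetric.1 hG
  let s : Finset ℕ := (finite_setOf_neg hGf ho hε).toFinset
  have hs : ∀ n, n ∈ s ↔ ε n < 0 := fun n => by simp [s]
  let Q : H →L[ℂ] H := ∑ n ∈ s, (innerSL ℂ (G (Φ n))).smulRight (G (Φ n))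
  have hQx : ∀ x, Q x = ∑ n ∈ s, ⟪Φ n, G x⟫ • G (Φ n) := fun x => by
    simp [Q, hGs]
  let G' : H →L[ℂ] H := G + (2 : ℂ) • Q
  have hG'x : ∀ x, G' x = G x + (2 : ℂ) • Q x := fun x => rfl
  have hQs : ∀ x y, ⟪Q x, y⟫ = ⟪x, Q y⟫ := fun x y => by
    rw [hQx, hQx, sum_inner, inner_sum]
    refine Finset.sum_congr rfl fun n _ => ?_
    rw [inner_smul_left, inner_smul_right, ← hGs (Φ n) x, inner_conj_symm, hGs (Φ n) y]
    ring
  have hG's : ∀ x y, ⟪G' x, y⟫ = ⟪x, G' y⟫ := fun x y => by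
    simp only [hG'x, inner_add_left, inner_add_right, inner_smul_left, inner_smul_right, hGs, hQs]
    rw [Complex.conj_ofNat]
  have hG'Φ : ∀ m, G' (Φ m) = (ε m : ℂ) • G (Φ m) := fun m => by
    have h1 : Q (Φ m) = if m ∈ s then (ε m : ℂ) • G (Φ m) else 0 := by
      rw [hQx]
      split_ifs with hm
      · rw [Finset.sum_eq_single_of_mem m hm fun n _ h => by rw [ho n m h, zero_smul], hε]
      · exact Finset.sum_eq_zero fun n hn => by
          rw [ho n m (fun h => hm (h ▸ hn)), zero_smul]
    rw [hG'x, h1]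
    rcases hε1 m with h | h
    · rw [if_neg (by rw [hs, h]; norm_num), h]; simp
    · rw [if_pos (by rw [hs, h]; norm_num), h, smul_smul]
      nth_rewrite 1 [← one_smul ℂ (G (Φ m))]
      rw [← add_smul]; norm_num
  have hΦG' : ∀ n x, ⟪Φ n, G' x⟫ = (ε n : ℂ) * ⟪Φ n, G x⟫ := fun n x => by
    rw [← hG's, hG'Φ, inner_smul_left, Complex.conj_ofReal, hGs]
  have hε0 : ∀ n, (ε n : ℂ) ≠ 0 := fun n => by
    rcases hε1 n with h | h <;> rw [h] <;> norm_num
  have hεε : ∀ n, (ε n : ℂ) * ε n = 1 := fun n => by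
    rcases hε1 n with h | h <;> rw [h] <;> norm_num
  have htot' : ∀ x, (∀ n, ⟪Φ n, G' x⟫ = 0) → x = 0 := fun x hx => htot x fun n =>
    (mul_eq_zero.1 ((hΦG' n x).symm.trans (hx n))).resolve_left (hε0 n)
  have hfin : FiniteDimensional ℂ (LinearMap.range ((1 - G' : H →L[ℂ] H) : H →ₗ[ℂ] H)) := by
    have := FiniteDimensional.span_of_finite ℂ (s.finite_toSet.image fun n => G (Φ n))
    refine Submodule.finiteDimensional_of_le (S₂ := LinearMap.range ((1 - G : H →L[ℂ] H) : H →ₗ[ℂ] H)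
      ⊔ Submodule.span ℂ ((fun n => G (Φ n)) '' s)) ?_
    rintro _ ⟨x, rfl⟩
    have h1 : (1 - G' : H →L[ℂ] H) x = (1 - G : H →L[ℂ] H) x - (2 : ℂ) • Q x := by
      simp [hG'x, sub_sub]
    change (1 - G' : H →L[ℂ] H) x ∈ _
    rw [h1]
    refine Submodule.sub_mem _ (Submodule.mem_sup_left ⟨x, rfl⟩)
      (Submodule.mem_sup_right (Submodule.smul_mem _ _ ?_))
    rw [hQx]
    exact Submodule.sum_mem _ fun n hn => Submodule.smul_mem _ _
      (Submodule.subset_span (Set.mem_image_of_mem _ hn))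
  have hu : IsUnit G' := by
    have hc := ContinuousLinearMap.isCompactOperator_of_finiteDimensional_range (1 - G')
    rcases hc.hasEigenvalue_or_mem_resolventSet one_ne_zero with h | hu
    · obtain ⟨x, hx⟩ := h.exists_hasEigenvector
      have hxV : G' x = 0 := by simpa using hx.apply_eq_smul
      exact (hx.2 (htot' x fun n => by rw [hxV, inner_zero_right])).elim
    · simpa [resolventSet, spectrum.mem_resolventSet_iff] using hu
  have hspan : ∀ x, (∀ n, ⟪Φ n, x⟫ = 0) → x = 0 := fun x hx => by
    obtain ⟨U, hU⟩ := hu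
    have h1 : G' (((U⁻¹ : (H →L[ℂ] H)ˣ) : H →L[ℂ] H) x) = x := by
      rw [← hU]; exact DFunLike.congr_fun U.mul_inv x
    have h2 := htot' _ fun n => by rw [h1, hx]
    rw [← h1, h2, map_zero]
  have hdense : (Submodule.span ℂ (Set.range Φ)).topologicalClosure = ⊤ := by
    rw [Submodule.topologicalClosure_eq_top_iff, Submodule.eq_bot_iff]
    exact fun x hx => hspan x fun n =>
      (Submodule.mem_orthogonal _ _).1 hx _ (Submodule.subset_span ⟨n, rfl⟩)
  have hpos : G'.IsPositive := by
    refine ContinuousLinearMap.isPositive_def.2 ⟨hG's, fun x => ?_⟩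
    have hcl : IsClosed {x | 0 ≤ G'.reApplyInnerSelf x} :=
      isClosed_le continuous_const G'.reApplyInnerSelf_continuous
    have hsub : ((Submodule.span ℂ (Set.range Φ) : Submodule ℂ H) : Set H)
        ⊆ {x | 0 ≤ G'.reApplyInnerSelf x} := fun x hx => by
      obtain ⟨c, rfl⟩ := (Finsupp.mem_span_range_iff_exists_finsupp).1 hx
      have := inner_sum_smul_of_orthogonal (G := G') (Φ := Φ) (ε := fun _ => 1)
        (fun m n h => by rw [hΦG', ho m n h, mul_zero])
        (fun n => by rw [hΦG', hε, hεε]; simp) c.support c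
      rw [Set.mem_ofPred_eq, ContinuousLinearMap.reApplyInnerSelf, hG's, Finsupp.sum, this]
      simp only [one_mul, RCLike.re_to_complex, Complex.ofReal_re]
      exact Finset.sum_nonneg fun n _ => Complex.normSq_nonneg _
    have hx : x ∈ (Submodule.span ℂ (Set.range Φ)).topologicalClosure := hdense ▸ trivial
    exact hcl.closure_subset_iff.2 hsub hx
  obtain ⟨S, hS, ⟨U, rfl⟩, hSS⟩ := hpos.exists_isUnit_sqrt hu
  have hSs : ∀ x y, ⟪(U : H →L[ℂ] H) x, y⟫ = ⟪x, (U : H →L[ℂ] H) y⟫ :=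
    ContinuousLinearMap.isSelfAdjoint_iff_isSymmetric.1 hS
  have hiU : ∀ x, ((U⁻¹ : (H →L[ℂ] H)ˣ) : H →L[ℂ] H) ((U : H →L[ℂ] H) x) = x := fun x =>
    DFunLike.congr_fun U.inv_mul x
  have hUU : ∀ n x, ⟪(U : H →L[ℂ] H) (Φ n), (U : H →L[ℂ] H) x⟫ = (ε n : ℂ) * ⟪Φ n, G x⟫ :=
    fun n x => by rw [hSs, ← hΦG', ← hSS]; rfl
  have hon : Orthonormal ℂ fun n => (U : H →L[ℂ] H) (Φ n) := by
    rw [orthonormal_iff_ite]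
    intro m n
    rw [hUU]
    split_ifs with h
    · rw [h, hε, hεε]
    · rw [ho m n h, mul_zero]
  have hbot : (Submodule.span ℂ (Set.range fun n => (U : H →L[ℂ] H) (Φ n)))ᗮ = ⊥ := by
    refine (Submodule.eq_bot_iff _).2 fun x hx => ?_
    have h1 : (U : H →L[ℂ] H) x = 0 := hspan _ fun n => by
      rw [← hSs]
      exact (Submodule.mem_orthogonal _ _).1 hx _ (Submodule.subset_span ⟨n, rfl⟩)
    rw [← hiU x, h1, map_zero]
  let b := HilbertBasis.mkOfOrthogonalEqBot hon hbot
  have hb := (b.hasSum_repr ((U : H →L[ℂ] H) f)).mapL ((U⁻¹ : (H →L[ℂ] H)ˣ) : H →L[ℂ] H)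
  rw [hiU] at hb
  convert hb.tendsto_sum_nat using 4 with N n
  rw [b.repr_apply_apply, map_smul, HilbertBasis.coe_mkOfOrthogonalEqBot, hUU, hiU]

end CompactPencil

section KernelOperator

variable {X : Type*} [MetricSpace X] [CompactSpace X]

/-- Pairing with a continuous family of vectors is a compact operator into the bounded continuous
functions. -/
theorem exists_isCompactOperator_inner {E : Type*} [NormedAddCommGroup E] [InnerProductSpace ℂ E]
    (κ : C(X, E)) : ∃ A : E →L[ℂ] BoundedContinuousFunction X ℂ, IsCompactOperator A ∧
      ∀ g x, A g x = inner ℂ (κ x) g := by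
  let A₀ : E →ₗ[ℂ] BoundedContinuousFunction X ℂ :=
    { toFun := fun g => BoundedContinuousFunction.mkOfCompact
        ⟨fun x => inner ℂ (κ x) g, κ.continuous.inner continuous_const⟩
      map_add' := fun f g => by ext x; exact inner_add_right _ _ _
      map_smul' := fun c g => by ext x; exact inner_smul_right _ _ _ }
  have hA₀ : ∀ g x, A₀ g x = inner ℂ (κ x) g := fun g x => rfl
  have hle : ∀ g x, ‖A₀ g x‖ ≤ ‖κ‖ * ‖g‖ := fun g x =>
    (norm_inner_le_norm _ _).trans (by gcongr; exact κ.norm_coe_le_norm x)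
  have hb : ∀ g, ‖A₀ g‖ ≤ ‖κ‖ * ‖g‖ := fun g =>
    (BoundedContinuousFunction.norm_le (by positivity)).2 (hle g)
  refine ⟨A₀.mkContinuous _ hb, ?_, hA₀⟩
  refine (isCompactOperator_iff_isCompact_closure_image_closedBall _ one_pos).2 ?_
  refine BoundedContinuousFunction.arzela_ascoli (Metric.closedBall (0 : ℂ) ‖κ‖)
    (isCompact_closedBall _ _) _ ?_ ?_
  · rintro _ x ⟨g, hg, rfl⟩
    rw [mem_closedBall_zero_iff] at hg ⊢
    exact (hle g x).trans (mul_le_of_le_one_right (norm_nonneg _) hg)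
  · refine fun x₀ => Metric.equicontinuousAt_of_continuity_modulus
      (fun x => dist (κ x₀) (κ x)) ?_ _ (Eventually.of_forall ?_)
    · have := (continuous_const.dist κ.continuous : Continuous fun x => dist (κ x₀) (κ x)).tendsto x₀
      rwa [dist_self] at this
    · rintro x ⟨_, g, hg, rfl⟩
      rw [mem_closedBall_zero_iff] at hg
      change dist (A₀ g x₀) (A₀ g x) ≤ _
      rw [dist_eq_norm, dist_eq_norm, hA₀, hA₀, ← inner_sub_left]
      exact (norm_inner_le_norm _ _).trans (mul_le_of_le_one_right (norm_nonneg _) hg)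

/-- A continuous symmetric real kernel on a compact space defines a compact self-adjoint integral
operator. -/
theorem exists_isCompactOperator_integral [MeasurableSpace X] [BorelSpace X] (μ : Measure X)
    [IsFiniteMeasure μ] (k : C(X × X, ℝ))
    (hk : ∀ x y, k (x, y) = k (y, x)) :
    ∃ A : Lp ℂ 2 μ →L[ℂ] Lp ℂ 2 μ, IsCompactOperator A ∧ (A : Lp ℂ 2 μ →ₗ[ℂ] Lp ℂ 2 μ).IsSymmetric ∧
      ∀ g, A g =ᵐ[μ] fun x => ∫ y, (k (x, y) : ℂ) * g y ∂μ := by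
  let kc : C(X × X, ℂ) := ⟨fun z => (k z : ℂ), Complex.continuous_ofReal.comp k.continuous⟩
  let κ : C(X, Lp ℂ 2 μ) :=
    ⟨fun x => ContinuousMap.toLp 2 μ ℂ (kc.curry x),
      (ContinuousMap.toLp 2 μ ℂ).continuous.comp kc.curry.continuous⟩
  have hκ : ∀ x g, inner ℂ (κ x) g = ∫ y, (k (x, y) : ℂ) * g y ∂μ := fun x g => by
    rw [L2.inner_def]
    refine integral_congr_ae ?_
    filter_upwards [ContinuousMap.coeFn_toLp (p := 2) (𝕜 := ℂ) μ (kc.curry x)] with y hy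
    change inner ℂ ((ContinuousMap.toLp 2 μ ℂ (kc.curry x) : Lp ℂ 2 μ) y) _ = _
    rw [hy]
    simp [kc, mul_comm]
  obtain ⟨A, hA, hAx⟩ := exists_isCompactOperator_inner κ
  let B : Lp ℂ 2 μ →L[ℂ] Lp ℂ 2 μ := (BoundedContinuousFunction.toLp 2 μ ℂ).comp A
  have hB : ∀ g, B g =ᵐ[μ] fun x => ∫ y, (k (x, y) : ℂ) * g y ∂μ := fun g => by
    filter_upwards [BoundedContinuousFunction.coeFn_toLp (p := 2) (𝕜 := ℂ) μ (A g)] with x hx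
    change (BoundedContinuousFunction.toLp 2 μ ℂ (A g) : Lp ℂ 2 μ) x = _
    rw [hx, hAx, hκ]
  refine ⟨B, hA.clm_comp (BoundedContinuousFunction.toLp 2 μ ℂ), fun f g => ?_, hB⟩
  have hInt : ∀ f : Lp ℂ 2 μ, Integrable f μ := fun f =>
    (Lp.memLp f).integrable (by norm_num)
  have h1 : inner ℂ (B f) g = ∫ x, ∫ y, (k (x, y) : ℂ) * (starRingEnd ℂ (f y) * g x) ∂μ ∂μ := by
    rw [L2.inner_def]
    refine integral_congr_ae ?_
    filter_upwards [hB f] with x hx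
    rw [hx, RCLike.inner_apply, ← integral_conj, ← integral_const_mul]
    refine integral_congr_ae (Eventually.of_forall fun y => ?_)
    simp; ring
  have h2 : inner ℂ f (B g) = ∫ x, ∫ y, (k (x, y) : ℂ) * (starRingEnd ℂ (f x) * g y) ∂μ ∂μ := by
    rw [L2.inner_def]
    refine integral_congr_ae ?_
    filter_upwards [hB g] with x hx
    rw [hx, RCLike.inner_apply, ← integral_mul_const]
    refine integral_congr_ae (Eventually.of_forall fun y => ?_)
    simp; ring
  change inner ℂ (B f) g = inner ℂ f (B g)
  rw [h1, h2, integral_integral_swap]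
  · refine integral_congr_ae (Eventually.of_forall fun x => integral_congr_ae
      (Eventually.of_forall fun y => ?_))
    simp only [hk y x]
  · have h3 : Integrable (fun z : X × X => g z.1 * starRingEnd ℂ (f z.2)) (μ.prod μ) :=
      (hInt g).mul_prod ((hInt f).congr'
        (Complex.continuous_conj.comp_aestronglyMeasurable (hInt f).1)
        (Eventually.of_forall fun y => by simp) : Integrable (fun y => starRingEnd ℂ (f y)) μ)
    refine (h3.bdd_mul kc.continuous.aestronglyMeasurable
      (Eventually.of_forall kc.norm_coe_le_norm)).congr (Eventually.of_forall fun z => ?_)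
    simp [kc, Function.uncurry, mul_comm]

end KernelOperator

section BlockOperator

variable {E : Type*} [NormedAddCommGroup E] [InnerProductSpace ℂ E] [CompleteSpace E]
  {ι : Type*} [Fintype ι]

local notation "⟪" x ", " y "⟫" => inner ℂ x y

/-- Expansion theorem for a compact symmetric operator coupled to finitely many scalar components,
where the component `j` carries the possibly negative weight `(D j)⁻¹`. -/
theorem tendsto_sum_of_compact_block {T₀ : E →L[ℂ] E} (hT₀ : IsCompactOperator T₀)
    (hs : (T₀ : E →ₗ[ℂ] E).IsSymmetric) (ξ : ι → E) {D : ι → ℝ} (hD : ∀ j, D j ≠ 0)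
    {M : ι → ι → ℝ} (hM : ∀ j k, (D j)⁻¹ * M j k = (D k)⁻¹ * M k j)
    (hinj : ∀ (g : E) (h : ι → ℂ), T₀ g + ∑ j, h j • ξ j = 0 → g = 0 ∧ h = 0)
    {φ : ℕ → E} {η : ℕ → ι → ℂ} {ν : ℕ → ℂ}
    (hφ : ∀ n, T₀ (φ n) + ∑ j, η n j • ξ j = ν n • φ n)
    (hη : ∀ n j, D j * ⟪ξ j, φ n⟫ + ∑ k, M j k * η n k = ν n * η n j)
    {ε : ℕ → ℝ} (hε1 : ∀ n, ε n = 1 ∨ ε n = -1)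
    (ho : ∀ m n, m ≠ n →
      ⟪φ m, φ n⟫ + ∑ j, (D j : ℂ)⁻¹ * (starRingEnd ℂ (η m j) * η n j) = 0)
    (hε : ∀ n, ⟪φ n, φ n⟫ + ∑ j, (D j : ℂ)⁻¹ * (starRingEnd ℂ (η n j) * η n j) = ε n)
    (hall : ∀ (μ : ℂ) (g : E) (h : ι → ℂ), ¬ (g = 0 ∧ h = 0) →
      T₀ g + ∑ j, h j • ξ j = μ • g →
      (∀ j, D j * ⟪ξ j, g⟫ + ∑ k, M j k * h k = μ * h j) →
      ∃ n, ⟪φ n, g⟫ + ∑ j, (D j : ℂ)⁻¹ * (starRingEnd ℂ (η n j) * h j) ≠ 0)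
    (g : E) (h : ι → ℂ) :
    Tendsto (fun N : ℕ => ∑ n ∈ Finset.range N, ((ε n : ℂ) *
      (⟪φ n, g⟫ + ∑ j, (D j : ℂ)⁻¹ * (starRingEnd ℂ (η n j) * h j))) • φ n) atTop (𝓝 g) := by
  let F := EuclideanSpace ℂ ι
  let H := WithLp 2 (E × F)
  let e : H ≃L[ℂ] E × F := WithLp.prodContinuousLinearEquiv 2 ℂ E F
  let p₁ : H →L[ℂ] E := (ContinuousLinearMap.fst ℂ E F).comp (e : H →L[ℂ] E × F)
  let p₂ : H →L[ℂ] F := (ContinuousLinearMap.snd ℂ E F).comp (e : H →L[ℂ] E × F)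
  let i₁ : E →L[ℂ] H := (e.symm : E × F →L[ℂ] H).comp (ContinuousLinearMap.inl ℂ E F)
  let i₂ : F →L[ℂ] H := (e.symm : E × F →L[ℂ] H).comp (ContinuousLinearMap.inr ℂ E F)
  let c : F ≃L[ℂ] (ι → ℂ) := EuclideanSpace.equiv ι ℂ
  let π : ι → F →L[ℂ] ℂ := fun j => (ContinuousLinearMap.proj j).comp (c : F →L[ℂ] ι → ℂ)
  let mk : E → (ι → ℂ) → H := fun g h => i₁ g + i₂ (c.symm h)
  have hmk : ∀ x : H, x = mk (p₁ x) (fun j => π j (p₂ x)) := fun x => by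
    apply e.injective
    ext <;> simp [mk, i₁, i₂, p₁, p₂, π]
  have hp₁ : ∀ g h, p₁ (mk g h) = g := fun g h => by simp [mk, i₁, i₂, p₁]
  have hp₂ : ∀ g h j, π j (p₂ (mk g h)) = h j := fun g h j => by simp [mk, i₁, i₂, p₂, π]
  have hmk0 : ∀ g h, mk g h = 0 ↔ g = 0 ∧ h = 0 := fun g h => by
    refine ⟨fun h0 => ⟨?_, funext fun j => ?_⟩, fun h0 => ?_⟩
    · rw [← hp₁ g h, h0, map_zero]
    · rw [← hp₂ g h j, h0, map_zero, map_zero]; rfl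
    · simp [mk, h0.1, h0.2]
  have hin : ∀ g h g' h', ⟪mk g h, mk g' h'⟫ = ⟪g, g'⟫ + ∑ j, starRingEnd ℂ (h j) * h' j :=
    fun g h g' h' => by
      have h1 : ∀ g h, mk g h = WithLp.toLp 2 (g, WithLp.toLp 2 h) := fun g h => by
        apply e.injective
        ext <;> simp [mk, i₁, i₂, e] <;> rfl
      rw [h1, h1, WithLp.prod_inner_apply, PiLp.inner_apply]
      simp [mul_comm]
  let g₂ : F →L[ℂ] F := (c.symm : (ι → ℂ) →L[ℂ] F).comp
    (ContinuousLinearMap.pi fun j => (D j : ℂ)⁻¹ • π j)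
  let G : H →L[ℂ] H := i₁.comp p₁ + i₂.comp (g₂.comp p₂)
  have hG : ∀ g h, G (mk g h) = mk g (fun j => (D j : ℂ)⁻¹ * h j) := fun g h => by
    change i₁ (p₁ (mk g h)) + i₂ (c.symm fun j => (D j : ℂ)⁻¹ * π j (p₂ (mk g h))) = _
    simp only [hp₁, hp₂, mk]
  let t₁ : F →L[ℂ] E := ∑ j, (π j).smulRight (ξ j)
  let t₂ : E →L[ℂ] F := (c.symm : (ι → ℂ) →L[ℂ] F).comp
    (ContinuousLinearMap.pi fun j => (D j : ℂ) • innerSL ℂ (ξ j))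
  let t₃ : F →L[ℂ] F := (c.symm : (ι → ℂ) →L[ℂ] F).comp
    (ContinuousLinearMap.pi fun j => ∑ k, (M j k : ℂ) • π k)
  let T : H →L[ℂ] H := i₁.comp (T₀.comp p₁) + i₁.comp (t₁.comp p₂)
    + i₂.comp (t₂.comp p₁ + t₃.comp p₂)
  have hT : ∀ g h, T (mk g h) = mk (T₀ g + ∑ j, h j • ξ j)
      (fun j => D j * ⟪ξ j, g⟫ + ∑ k, M j k * h k) := fun g h => by
    have h1 : T (mk g h) = i₁ (T₀ (p₁ (mk g h))) + i₁ (∑ j, π j (p₂ (mk g h)) • ξ j)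
        + i₂ ((c.symm fun j => D j * ⟪ξ j, p₁ (mk g h)⟫)
          + c.symm fun j => ∑ k, M j k * π k (p₂ (mk g h))) := by
      simp only [T, t₁, t₂, t₃, add_apply, ContinuousLinearMap.comp_apply, sum_apply,
        ContinuousLinearMap.smulRight_apply, ContinuousLinearEquiv.coe_coe]
      congr 4 <;> ext j <;> simp [ContinuousLinearMap.pi_apply]
    rw [h1, ← map_add, ← map_add]
    simp only [hp₁, hp₂, mk]
    rfl
  have hGs : ∀ x y, ⟪G x, y⟫ = ⟪x, G y⟫ := fun x y => by
    rw [hmk x, hmk y, hG, hG, hin, hin]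
    congr 1
    refine Finset.sum_congr rfl fun j _ => ?_
    rw [map_mul, map_inv₀, Complex.conj_ofReal]; ring
  have hGf : FiniteDimensional ℂ (LinearMap.range ((1 - G : H →L[ℂ] H) : H →ₗ[ℂ] H)) := by
    refine Submodule.finiteDimensional_of_le (S₂ := LinearMap.range (i₂ : F →ₗ[ℂ] H)) ?_
    rintro _ ⟨x, rfl⟩
    refine ⟨p₂ x - g₂ (p₂ x), ?_⟩
    have h1 : x = i₁ (p₁ x) + i₂ (p₂ x) := by
      conv_lhs => rw [hmk x]
      rfl
    change i₂ (p₂ x - g₂ (p₂ x)) = x - (i₁ (p₁ x) + i₂ (g₂ (p₂ x)))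
    nth_rewrite 3 [h1]
    rw [map_sub]; abel
  have hTc : IsCompactOperator T := by
    have h1 : IsCompactOperator (i₁.comp (T₀.comp p₁)) := (hT₀.comp_clm p₁).clm_comp i₁
    have h2 : IsCompactOperator (i₁.comp (t₁.comp p₂)) :=
      (isCompactOperator_of_locallyCompactSpace_dom p₂).clm_comp (i₁.comp t₁)
    have h3 : IsCompactOperator (i₂.comp (t₂.comp p₁ + t₃.comp p₂)) :=
      (isCompactOperator_of_locallyCompactSpace_dom (t₂.comp p₁ + t₃.comp p₂)).clm_comp i₂
    exact (h1.add h2).add h3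
  have hGT : ∀ x y, ⟪T x, G y⟫ = ⟪x, G (T y)⟫ := fun x y => by
    obtain ⟨g, h, rfl⟩ : ∃ g h, x = mk g h := ⟨_, _, hmk x⟩
    obtain ⟨g', h', rfl⟩ : ∃ g h, y = mk g h := ⟨_, _, hmk y⟩
    have hs' : ⟪T₀ g, g'⟫ = ⟪g, T₀ g'⟫ := hs g g'
    rw [hT, hT, hG, hG, hin, hin, inner_add_left, inner_add_right, sum_inner, inner_sum,
      hs', add_assoc, add_assoc]
    congr 1
    have hDc : ∀ j, (D j : ℂ) ≠ 0 := fun j => Complex.ofReal_ne_zero.2 (hD j)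
    have hMc : ∀ j k, (D j : ℂ)⁻¹ * M j k = (D k : ℂ)⁻¹ * M k j := fun j k => by
      exact_mod_cast congrArg (Complex.ofReal) (hM j k)
    have h1 : ∑ j, starRingEnd ℂ (D j * ⟪ξ j, g⟫ + ∑ k, M j k * h k) * ((D j : ℂ)⁻¹ * h' j)
        = ∑ j, ⟪g, h' j • ξ j⟫
          + ∑ j, ∑ k, (D j : ℂ)⁻¹ * M j k * (starRingEnd ℂ (h k) * h' j) := by
      rw [← Finset.sum_add_distrib]
      refine Finset.sum_congr rfl fun j _ => ?_
      rw [map_add, add_mul, map_sum, Finset.sum_mul, map_mul, inner_conj_symm, inner_smul_right,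
        Complex.conj_ofReal]
      congr 1
      · field_simp [hDc j]
      · refine Finset.sum_congr rfl fun k _ => ?_
        rw [map_mul, Complex.conj_ofReal]; ring
    have h2 : ∑ j, starRingEnd ℂ (h j) * ((D j : ℂ)⁻¹ * (D j * ⟪ξ j, g'⟫ + ∑ k, M j k * h' k))
        = ∑ j, ⟪h j • ξ j, g'⟫
          + ∑ j, ∑ k, (D j : ℂ)⁻¹ * M j k * (starRingEnd ℂ (h j) * h' k) := by
      rw [← Finset.sum_add_distrib]
      refine Finset.sum_congr rfl fun j _ => ?_
      rw [inner_smul_left, mul_add, mul_add, Finset.mul_sum, Finset.mul_sum]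
      congr 1
      · field_simp [hDc j]
      · refine Finset.sum_congr rfl fun k _ => ?_
        ring
    rw [h1, h2, Finset.sum_comm (f := fun j k => (D j : ℂ)⁻¹ * M j k * (starRingEnd ℂ (h k) * h' j))]
    simp only [hMc]
    ring
  let Φ : ℕ → H := fun n => mk (φ n) (η n)
  have hΦ : ∀ n g h, ⟪Φ n, G (mk g h)⟫
      = ⟪φ n, g⟫ + ∑ j, (D j : ℂ)⁻¹ * (starRingEnd ℂ (η n j) * h j) := fun n g h => by
    rw [hG, hin]
    congr 1
    exact Finset.sum_congr rfl fun j _ => by ring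
  have hmksmul : ∀ (μ : ℂ) g h, μ • mk g h = mk (μ • g) (fun j => μ * h j) := fun μ g h => by
    rw [hmk (μ • mk g h)]
    simp only [map_smul, smul_eq_mul, hp₁, hp₂]
  have hmkinj : ∀ g h g' h', mk g h = mk g' h' → g = g' ∧ ∀ j, h j = h' j := fun g h g' h' H => by
    refine ⟨?_, fun j => ?_⟩
    · rw [← hp₁ g h, H, hp₁]
    · rw [← hp₂ g h j, H, hp₂]
  have htot : ∀ x, (∀ n, ⟪Φ n, G x⟫ = 0) → x = 0 := fun x hx => by
    refine eq_zero_of_forall_inner_eq_zero (ContinuousLinearMap.isSelfAdjoint_iff_isSymmetric.2 hGs)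
      hGf hTc (fun x hx => ?_) hGT (Φ := Φ) (ν := ν) (fun n => ?_) (fun μ x hx0 hx => ?_) hx
    · rw [hmk x] at hx ⊢
      rw [hT] at hx
      exact (hmk0 _ _).2 (hinj _ _ ((hmk0 _ _).1 hx).1)
    · change T (mk _ _) = _ • mk _ _
      rw [hT, hmksmul, hφ]
      congr 1
      exact funext (hη n)
    · rw [hmk x] at hx hx0
      rw [hT, hmksmul] at hx
      obtain ⟨h1, h2⟩ := hmkinj _ _ _ _ hx
      obtain ⟨n, hn⟩ := hall μ _ _ (fun h => hx0 ((hmk0 _ _).2 h)) h1 h2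
      exact ⟨n, by rw [hmk x, hΦ]; exact hn⟩
  have key := tendsto_sum_inner_smul (ContinuousLinearMap.isSelfAdjoint_iff_isSymmetric.2 hGs) hGf
    (Φ := Φ) (fun m n h => (hΦ m _ _).trans (ho m n h)) (fun n => (hΦ n _ _).trans (hε n)) hε1
    htot (mk g h)
  have := (p₁.continuous.tendsto _).comp key
  rw [hp₁] at this
  refine this.congr fun N => ?_
  simp only [Function.comp_apply, map_sum, map_smul, hΦ]
  exact Finset.sum_congr rfl fun n _ => by rw [hp₁]

end BlockOperator

section LinearSystem

theorem exists_hasDerivWithinAt_linear_system {P Q : ℝ → ℝ} (hP : Continuous P)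
    (hQ : Continuous Q) {a b : ℝ} (hab : a ≤ b) (x₀ y₀ : ℝ) :
    ∃ u U : ℝ → ℝ, u a = x₀ ∧ U a = y₀ ∧ ∀ t ∈ Set.Icc a b,
      HasDerivWithinAt u (P t * U t) (Set.Icc a b) t ∧
      HasDerivWithinAt U (Q t * u t) (Set.Icc a b) t := by
  obtain ⟨K₁, hK₁⟩ := isCompact_Icc.exists_bound_of_continuousOn (s := Set.Icc a b) hP.continuousOn
  obtain ⟨K₂, hK₂⟩ := isCompact_Icc.exists_bound_of_continuousOn (s := Set.Icc a b) hQ.continuousOn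
  let K : ℝ := max (max K₁ K₂) 0
  have hK0 : 0 ≤ K := le_max_right _ _
  have hPK : ∀ t ∈ Set.Icc a b, |P t| ≤ K := fun t ht =>
    (hK₁ t ht).trans ((le_max_left _ _).trans (le_max_left _ _))
  have hQK : ∀ t ∈ Set.Icc a b, |Q t| ≤ K := fun t ht =>
    (hK₂ t ht).trans ((le_max_right _ _).trans (le_max_left _ _))
  let δ : ℝ := ‖((x₀, y₀) : ℝ × ℝ)‖
  let R : ℝ := δ * Real.exp (K * (b - a))
  have hR : 0 ≤ R := by positivity
  let κ : ℝ → ℝ := fun x => max (-R) (min x R)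
  have hκl : ∀ x y, |κ x - κ y| ≤ |x - y| := fun x y =>
    (abs_max_sub_max_le_max _ _ _ _).trans (by
      simpa using (abs_min_sub_min_le_max x R y R))
  have hκ0 : κ 0 = 0 := by simp [κ, hR]
  have hκa : ∀ x, |κ x| ≤ |x| := fun x => by simpa [hκ0] using hκl x 0
  have hκR : ∀ x, |κ x| ≤ R := fun x => abs_le.2
    ⟨le_max_left _ _, max_le (by linarith) (min_le_right _ _)⟩
  have hκe : ∀ x, |x| ≤ R → κ x = x := fun x hx => by
    obtain ⟨h1, h2⟩ := abs_le.1 hx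
    simp [κ, h1, h2]
  let f : ℝ → ℝ × ℝ → ℝ × ℝ := fun t x => (P t * κ x.2, Q t * κ x.1)
  have hpl : IsPicardLindelof f (⟨a, le_refl a, hab⟩ : Set.Icc a b) (x₀, y₀)
      (⟨K * R * (b - a), by have := sub_nonneg.2 hab; positivity⟩) 0
      ⟨K * R, by positivity⟩ ⟨K, hK0⟩ := by
    refine ⟨fun t ht => LipschitzOnWith.of_dist_le_mul fun x _ y _ => ?_, fun x _ => ?_,
      fun t ht x _ => ?_, ?_⟩
    · rw [Prod.dist_eq, Real.dist_eq, Real.dist_eq, ← mul_sub, ← mul_sub, abs_mul, abs_mul]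
      refine max_le (mul_le_mul (hPK t ht) ((hκl _ _).trans ?_) (abs_nonneg _) hK0)
        (mul_le_mul (hQK t ht) ((hκl _ _).trans ?_) (abs_nonneg _) hK0)
      · exact le_max_right (dist x.1 y.1) (dist x.2 y.2)
      · exact le_max_left (dist x.1 y.1) (dist x.2 y.2)
    · exact ((hP.mul continuous_const).prodMk (hQ.mul continuous_const)).continuousOn
    · refine max_le ?_ ?_
      · rw [Real.norm_eq_abs, abs_mul]
        exact mul_le_mul (hPK t ht) (hκR _) (abs_nonneg _) hK0
      · rw [Real.norm_eq_abs, abs_mul]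
        exact mul_le_mul (hQK t ht) (hκR _) (abs_nonneg _) hK0
    · change K * R * max (b - a) (a - a) ≤ K * R * (b - a) - 0
      rw [sub_self, max_eq_left (sub_nonneg.2 hab), sub_zero]
  obtain ⟨x, hx0, hx⟩ := hpl.exists_eq_forall_mem_Icc_hasDerivWithinAt₀
  have hx0' : x a = (x₀, y₀) := hx0
  have hbd := norm_le_gronwallBound_of_norm_deriv_right_le (f := x) (f' := fun t => f t (x t))
    (δ := δ) (K := K) (ε := 0) (a := a) (b := b)
    (fun t ht => (hx t ht).continuousWithinAt)
    (fun t ht => ((hx t (Set.Ico_subset_Icc_self ht)).mono_of_mem_nhdsWithin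
      (Icc_mem_nhdsGE_of_mem ht)))
    (by rw [hx0']) (fun t ht => by
      have ht := Set.Ico_subset_Icc_self ht
      rw [add_zero]
      refine max_le ?_ ?_
      · rw [Real.norm_eq_abs, abs_mul]
        exact mul_le_mul (hPK t ht) ((hκa _).trans (norm_snd_le (x t))) (abs_nonneg _) hK0
      · rw [Real.norm_eq_abs, abs_mul]
        exact mul_le_mul (hQK t ht) ((hκa _).trans (norm_fst_le (x t))) (abs_nonneg _) hK0)
  have hxR : ∀ t ∈ Set.Icc a b, ‖x t‖ ≤ R := fun t ht => by
    refine (hbd t ht).trans ?_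
    rw [gronwallBound_ε0]
    exact mul_le_mul_of_nonneg_left (Real.exp_le_exp.2
      (mul_le_mul_of_nonneg_left (by linarith [ht.2]) hK0)) (norm_nonneg _)
  refine ⟨fun t => (x t).1, fun t => (x t).2, by simp [hx0'], by simp [hx0'], fun t ht => ?_⟩
  have h1 := (hx t ht).fst
  have h2 := (hx t ht).snd
  simp only [f, hκe _ ((norm_fst_le (x t)).trans (hxR t ht)),
    hκe _ ((norm_snd_le (x t)).trans (hxR t ht))] at h1 h2
  exact ⟨h1, h2⟩

theorem exists_fundamental_system {P Q : ℝ → ℝ} (hP : Continuous P)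
    (hQ : Continuous Q) {a b : ℝ} (hab : a ≤ b) :
    ∃ u U v V : ℝ → ℝ, (∀ t ∈ Set.Icc a b, HasDerivAt u (P t * U t) t ∧
      HasDerivAt U (Q t * u t) t ∧ HasDerivAt v (P t * V t) t ∧ HasDerivAt V (Q t * v t) t) ∧
      ∀ t ∈ Set.Icc a b, u t * V t - U t * v t = 1 := by
  have hab' : a - 1 ≤ b + 1 := by linarith
  obtain ⟨u, U, hu, hU, h⟩ := exists_hasDerivWithinAt_linear_system hP hQ hab' 1 0
  obtain ⟨v, V, hv, hV, h'⟩ := exists_hasDerivWithinAt_linear_system hP hQ hab' 0 1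
  have hsub : Set.Icc a b ⊆ Set.Icc (a - 1) (b + 1) := Set.Icc_subset_Icc (by linarith) (by linarith)
  have hn : ∀ t ∈ Set.Icc a b, Set.Icc (a - 1) (b + 1) ∈ 𝓝 t := fun t ht =>
    Icc_mem_nhds (by linarith [ht.1]) (by linarith [ht.2])
  have hW : ∀ t ∈ Set.Icc (a - 1) (b + 1),
      HasDerivWithinAt (fun t => u t * V t - U t * v t) 0 (Set.Icc (a - 1) (b + 1)) t :=
    fun t ht => by
      exact (((h t ht).1.mul (h' t ht).2).sub ((h t ht).2.mul (h' t ht).1)).congr_deriv (by ring)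
  have hW1 := constant_of_has_deriv_right_zero (fun t ht => (hW t ht).continuousWithinAt)
    (fun t ht => (hW t (Set.Ico_subset_Icc_self ht)).mono_of_mem_nhdsWithin
      (Icc_mem_nhdsGE_of_mem ht))
  refine ⟨u, U, v, V, fun t ht => ⟨(h t (hsub ht)).1.hasDerivAt (hn t ht),
    (h t (hsub ht)).2.hasDerivAt (hn t ht), (h' t (hsub ht)).1.hasDerivAt (hn t ht),
    (h' t (hsub ht)).2.hasDerivAt (hn t ht)⟩, fun t ht => ?_⟩
  rw [hW1 t (hsub ht), hu, hU, hv, hV]; norm_num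

/-- A function on `[a, b]` with a continuous second derivative extends to `ℝ`. -/
theorem exists_contDiff_two_extension {a b : ℝ} (hab : a ≤ b) {f f' f'' : ℝ → ℂ}
    (hf : ∀ t ∈ Set.Icc a b, HasDerivWithinAt f (f' t) (Set.Icc a b) t)
    (hf' : ∀ t ∈ Set.Icc a b, HasDerivWithinAt f' (f'' t) (Set.Icc a b) t)
    (hf'' : ContinuousOn f'' (Set.Icc a b)) :
    ∃ F : ℝ → ℂ, ContDiff ℝ 2 F ∧ ∀ t ∈ Set.Icc a b, F t = f t ∧ deriv F t = f' t := by
  let g'' : ℝ → ℂ := Set.IccExtend hab (fun t : Set.Icc a b => f'' t)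
  have hg'' : Continuous g'' := (continuousOn_iff_continuous_domRestrict.1 hf'').Icc_extend'
  have key : ∀ {h h' g' : ℝ → ℂ}, Continuous g' → (∀ t ∈ Set.Icc a b, g' t = h' t) →
      (∀ t ∈ Set.Icc a b, HasDerivWithinAt h (h' t) (Set.Icc a b) t) →
      ∀ t ∈ Set.Icc a b, h a + ∫ x in a..t, g' x = h t := fun {h h' g'} hg hgh hh t ht => by
    have := intervalIntegral.integral_eq_sub_of_hasDeriv_right_of_le ht.1
      (f := h) (f' := g')
      (fun x hx => ((hh x ⟨hx.1, hx.2.trans ht.2⟩).continuousWithinAt).mono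
        (Set.Icc_subset_Icc_right ht.2))
      (fun x hx => by
        have hx' : x ∈ Set.Ico a b := ⟨hx.1.le, hx.2.trans_le ht.2⟩
        rw [hgh x (Set.Ico_subset_Icc_self hx')]
        exact ((hh x (Set.Ico_subset_Icc_self hx')).mono_of_mem_nhdsWithin
          (Icc_mem_nhdsGE_of_mem hx')).mono Set.Ioi_subset_Ici_self)
      (hg.intervalIntegrable _ _)
    rw [this]; ring
  let g' : ℝ → ℂ := fun t => f' a + ∫ x in a..t, g'' x
  have hg' : ∀ t, HasDerivAt g' (g'' t) t := fun t =>
    (hg''.integral_hasStrictDerivAt a t).hasDerivAt.const_add _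
  have hg'c : Continuous g' := continuous_iff_continuousAt.2 fun t => (hg' t).continuousAt
  let F : ℝ → ℂ := fun t => f a + ∫ x in a..t, g' x
  have hF : ∀ t, HasDerivAt F (g' t) t := fun t =>
    (hg'c.integral_hasStrictDerivAt a t).hasDerivAt.const_add _
  have h1 : ∀ t ∈ Set.Icc a b, g' t = f' t :=
    key hg'' (fun t ht => Set.IccExtend_of_mem hab _ ht) hf'
  refine ⟨F, ?_, fun t ht => ⟨key hg'c h1 hf t ht, (hF t).deriv.trans (h1 t ht)⟩⟩
  have hd1 : deriv F = g' := funext fun t => (hF t).deriv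
  have hd2 : deriv g' = g'' := funext fun t => (hg' t).deriv
  have e2 : (2 : WithTop ℕ∞) = 1 + 1 := by norm_num
  rw [e2, contDiff_succ_iff_deriv]
  refine ⟨fun t => (hF t).differentiableAt, by simp, ?_⟩
  rw [hd1, contDiff_one_iff_deriv, hd2]
  exact ⟨fun t => (hg' t).differentiableAt, hg''⟩

end LinearSystem

theorem ContinuousOn.hasDerivWithinAt_integral_Icc {a b : ℝ} {f : ℝ → ℂ}
    (hf : ContinuousOn f (Set.Icc a b)) {c x : ℝ} (hc : c ∈ Set.Icc a b) (hx : x ∈ Set.Icc a b) :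
    HasDerivWithinAt (fun x => ∫ t in c..x, f t) (f x) (Set.Icc a b) x := by
  have hab : a ≤ b := hx.1.trans hx.2
  let g : ℝ → ℂ := Set.IccExtend hab (fun t : Set.Icc a b => f t)
  have hg : Continuous g := (continuousOn_iff_continuous_domRestrict.1 hf).Icc_extend'
  have hgf : ∀ t ∈ Set.Icc a b, g t = f t := fun t ht => Set.IccExtend_of_mem hab _ ht
  have h1 : ∀ y ∈ Set.Icc a b, ∫ t in c..y, f t = ∫ t in c..y, g t := fun y hy =>
    intervalIntegral.integral_congr fun t ht => (hgf t (Set.uIcc_subset_Icc hc hy ht)).symm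
  rw [← hgf x hx]
  exact ((hg.integral_hasStrictDerivAt c x).hasDerivAt.hasDerivWithinAt).congr h1 (h1 x hx)

/-- Two solutions `y 0`, `y 1` of the first order system `y' = P Y`, `Y' = Q y` on `[a, b]` whose
Wronskian is `w⁻¹`. -/
structure GreenData (a b : ℝ) (P Q : ℝ → ℝ) where
  y : Fin 2 → ℝ → ℝ
  Y : Fin 2 → ℝ → ℝ
  w : ℝ
  hasDerivAt_y : ∀ j, ∀ t ∈ Set.Icc a b, HasDerivAt (y j) (P t * Y j t) t
  hasDerivAt_Y : ∀ j, ∀ t ∈ Set.Icc a b, HasDerivAt (Y j) (Q t * y j t) t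
  wronskian : ∀ t ∈ Set.Icc a b, w * (y 0 t * Y 1 t - Y 0 t * y 1 t) = 1

namespace GreenData

variable {a b : ℝ} {P Q : ℝ → ℝ} (S : GreenData a b P Q)

/-- The Green operator, the solution operator of the inhomogeneous system `u' = P U`,
`U' = Q u - G`. -/
noncomputable def green (G : ℝ → ℂ) (x : ℝ) : ℂ :=
  S.w * (S.y 0 x * (∫ t in a..x, (S.y 1 t : ℂ) * G t) + S.y 1 x * ∫ t in x..b, (S.y 0 t : ℂ) * G t)

/-- The quasi-derivative of `GreenData.green`. -/
noncomputable def greenDeriv (G : ℝ → ℂ) (x : ℝ) : ℂ :=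
  S.w * (S.Y 0 x * (∫ t in a..x, (S.y 1 t : ℂ) * G t) + S.Y 1 x * ∫ t in x..b, (S.y 0 t : ℂ) * G t)

theorem continuousOn_y (j : Fin 2) : ContinuousOn (fun t => (S.y j t : ℂ)) (Set.Icc a b) :=
  fun t ht => (S.hasDerivAt_y j t ht).ofReal_comp.continuousAt.continuousWithinAt

theorem wronskian_ofReal {t : ℝ} (ht : t ∈ Set.Icc a b) :
    (S.w : ℂ) * (S.y 0 t * S.Y 1 t - S.Y 0 t * S.y 1 t) = 1 := by
  exact_mod_cast S.wronskian t ht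

theorem intervalIntegrable_y_mul (hab : a ≤ b) (j : Fin 2) {G : ℝ → ℂ}
    (hG : IntervalIntegrable G volume a b) :
    IntervalIntegrable (fun t => (S.y j t : ℂ) * G t) volume a b :=
  hG.continuousOn_mul (by rw [Set.uIcc_of_le hab]; exact S.continuousOn_y j)

section Eigen

variable {f F G : ℝ → ℂ}
  (hf : ∀ t ∈ Set.Icc a b, HasDerivAt f (P t * F t) t)
  (hF : ∀ t ∈ Set.Icc a b, HasDerivAt F (Q t * f t - G t) t)

include hf hF in
theorem integral_y_mul_eq (hG : ContinuousOn G (Set.Icc a b)) (j : Fin 2) {c x : ℝ}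
    (hc : c ∈ Set.Icc a b) (hx : x ∈ Set.Icc a b) :
    ∫ t in c..x, (S.y j t : ℂ) * G t =
      (S.y j c * F c - S.Y j c * f c) - (S.y j x * F x - S.Y j x * f x) := by
  have hsub := Set.uIcc_subset_Icc hc hx
  have := intervalIntegral.integral_eq_sub_of_hasDerivAt (a := c) (b := x)
    (f := fun t => (S.Y j t * f t - S.y j t * F t : ℂ)) (f' := fun t => (S.y j t : ℂ) * G t)
    (fun t ht => by
      have ht := hsub ht
      refine (((S.hasDerivAt_Y j t ht).ofReal_comp.mul (hf t ht)).sub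
        ((S.hasDerivAt_y j t ht).ofReal_comp.mul (hF t ht))).congr_deriv ?_
      push_cast
      ring)
    (((S.continuousOn_y j).mul hG).mono hsub).intervalIntegrable
  rw [this]; ring

include hf hF in
theorem green_eq (hG : ContinuousOn G (Set.Icc a b)) {x : ℝ} (hx : x ∈ Set.Icc a b) :
    S.green G x = f x + S.w * (S.y 0 x * (S.y 1 a * F a - S.Y 1 a * f a)
      - S.y 1 x * (S.y 0 b * F b - S.Y 0 b * f b)) := by
  have hab := hx.1.trans hx.2
  rw [green, S.integral_y_mul_eq hf hF hG 1 (Set.left_mem_Icc.2 hab) hx,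
    S.integral_y_mul_eq hf hF hG 0 hx (Set.right_mem_Icc.2 hab)]
  linear_combination f x * S.wronskian_ofReal hx

end Eigen

section Inhomogeneous

variable {G : ℝ → ℂ}

theorem hasDerivWithinAt_green (hG : ContinuousOn G (Set.Icc a b)) {x : ℝ}
    (hx : x ∈ Set.Icc a b) :
    HasDerivWithinAt (S.green G) (P x * S.greenDeriv G x) (Set.Icc a b) x := by
  have hab := hx.1.trans hx.2
  have h1 : HasDerivWithinAt (fun x => ∫ t in a..x, (S.y 1 t : ℂ) * G t) (S.y 1 x * G x)
      (Set.Icc a b) x := ((S.continuousOn_y 1).mul hG).hasDerivWithinAt_integral_Icc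
    (Set.left_mem_Icc.2 hab) hx
  have h0 : HasDerivWithinAt (fun x => ∫ t in x..b, (S.y 0 t : ℂ) * G t) (-(S.y 0 x * G x))
      (Set.Icc a b) x := by
    simp only [intervalIntegral.integral_symm b]
    exact (((S.continuousOn_y 0).mul hG).hasDerivWithinAt_integral_Icc
      (Set.right_mem_Icc.2 hab) hx).neg
  refine ((((S.hasDerivAt_y 0 x hx).ofReal_comp.hasDerivWithinAt.mul h1).add
    ((S.hasDerivAt_y 1 x hx).ofReal_comp.hasDerivWithinAt.mul h0)).const_mul
      (S.w : ℂ)).congr_deriv ?_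
  simp only [greenDeriv]
  push_cast
  ring

theorem hasDerivWithinAt_greenDeriv (hG : ContinuousOn G (Set.Icc a b)) {x : ℝ}
    (hx : x ∈ Set.Icc a b) :
    HasDerivWithinAt (S.greenDeriv G) (Q x * S.green G x - G x) (Set.Icc a b) x := by
  have hab := hx.1.trans hx.2
  have h1 : HasDerivWithinAt (fun x => ∫ t in a..x, (S.y 1 t : ℂ) * G t) (S.y 1 x * G x)
      (Set.Icc a b) x := ((S.continuousOn_y 1).mul hG).hasDerivWithinAt_integral_Icc
    (Set.left_mem_Icc.2 hab) hx
  have h0 : HasDerivWithinAt (fun x => ∫ t in x..b, (S.y 0 t : ℂ) * G t) (-(S.y 0 x * G x))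
      (Set.Icc a b) x := by
    simp only [intervalIntegral.integral_symm b]
    exact (((S.continuousOn_y 0).mul hG).hasDerivWithinAt_integral_Icc
      (Set.right_mem_Icc.2 hab) hx).neg
  refine ((((S.hasDerivAt_Y 0 x hx).ofReal_comp.hasDerivWithinAt.mul h1).add
    ((S.hasDerivAt_Y 1 x hx).ofReal_comp.hasDerivWithinAt.mul h0)).const_mul
      (S.w : ℂ)).congr_deriv ?_
  simp only [green]
  push_cast
  linear_combination - G x * S.wronskian_ofReal hx

theorem continuousOn_green (hab : a ≤ b) (hG : IntervalIntegrable G volume a b) :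
    ContinuousOn (S.green G) (Set.Icc a b) := by
  have h1 := intervalIntegral.continuousOn_primitive_interval'
    (S.intervalIntegrable_y_mul hab 1 hG) Set.left_mem_uIcc
  have h0 : ContinuousOn (fun x => ∫ t in x..b, (S.y 0 t : ℂ) * G t) (Set.uIcc a b) := by
    simp only [intervalIntegral.integral_symm b]
    exact (intervalIntegral.continuousOn_primitive_interval'
      (S.intervalIntegrable_y_mul hab 0 hG) Set.right_mem_uIcc).neg
  rw [Set.uIcc_of_le hab] at h0 h1
  exact continuousOn_const.mul (((S.continuousOn_y 0).mul h1).add ((S.continuousOn_y 1).mul h0))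

/-- The Green operator together with the fundamental solutions is injective. -/
theorem eq_zero_of_green_add_eq_zero (hab : a < b) (hP : ∀ t ∈ Set.Icc a b, P t ≠ 0)
    (hG : IntervalIntegrable G volume a b) {h : Fin 2 → ℂ}
    (h0 : ∀ x ∈ Set.Icc a b, S.green G x + (h 0 * S.y 0 x + h 1 * S.y 1 x) = 0) :
    (∀ᵐ x, x ∈ Set.Icc a b → G x = 0) ∧ h = 0 := by
  have hw : (S.w : ℂ) ≠ 0 := fun hw => by
    simpa [hw] using S.wronskian_ofReal (Set.left_mem_Icc.2 hab.le)
  have hi := fun j => S.intervalIntegrable_y_mul hab.le j hG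
  let A : ℝ → ℂ := fun x => S.w * (∫ t in a..x, (S.y 1 t : ℂ) * G t) + h 0
  let B : ℝ → ℂ := fun x => S.w * (∫ t in x..b, (S.y 0 t : ℂ) * G t) + h 1
  have hAB : ∀ x ∈ Set.Icc a b, S.y 0 x * A x + S.y 1 x * B x = 0 := fun x hx => by
    rw [← h0 x hx, green]; ring
  have hcA : ContinuousOn A (Set.Icc a b) := by
    have h1 := intervalIntegral.continuousOn_primitive_interval' (hi 1) Set.left_mem_uIcc
    rw [Set.uIcc_of_le hab.le] at h1
    exact (continuousOn_const.mul h1).add continuousOn_const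
  have hcB : ContinuousOn B (Set.Icc a b) := by
    have h1 : ContinuousOn (fun x => ∫ t in x..b, (S.y 0 t : ℂ) * G t) (Set.uIcc a b) := by
      simp only [intervalIntegral.integral_symm b]
      exact (intervalIntegral.continuousOn_primitive_interval' (hi 0) Set.right_mem_uIcc).neg
    rw [Set.uIcc_of_le hab.le] at h1
    exact (continuousOn_const.mul h1).add continuousOn_const
  have hd : ∀ᵐ x, x ∈ Set.Icc a b → HasDerivAt A (S.w * (S.y 1 x * G x)) x ∧
      HasDerivAt B (-(S.w * (S.y 0 x * G x))) x := by
    filter_upwards [(hi 1).ae_hasDerivAt_integral, (hi 0).ae_hasDerivAt_integral] with x h1 h2 hx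
    rw [Set.uIcc_of_le hab.le] at h1 h2
    have h1 := ((h1 hx a (Set.left_mem_Icc.2 hab.le)).const_mul (S.w : ℂ)).add_const (h 0)
    have h2 := ((h2 hx b (Set.right_mem_Icc.2 hab.le)).neg.const_mul (S.w : ℂ)).add_const (h 1)
    refine ⟨h1, (h2.congr_deriv (by ring)).congr_of_eventuallyEq (Eventually.of_forall fun y => ?_)⟩
    simp [B, intervalIntegral.integral_symm b y]
  have hae : ∀ᵐ x, x ∈ Set.Icc a b → x ∈ Set.Ioo a b := by
    filter_upwards [Ioo_ae_eq_Icc (a := a) (b := b) (μ := volume)] with x hx h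
    exact (iff_of_eq hx).2 h
  have hz : ∀ᵐ x, x ∈ Set.Icc a b → A x = 0 ∧ B x = 0 := by
    filter_upwards [hd, hae] with x hdx hx' hx
    obtain ⟨dA, dB⟩ := hdx hx
    have d1 := ((S.hasDerivAt_y 0 x hx).ofReal_comp.mul dA).add
      ((S.hasDerivAt_y 1 x hx).ofReal_comp.mul dB)
    have d2 : HasDerivAt (fun x => S.y 0 x * A x + S.y 1 x * B x) 0 x :=
      (hasDerivAt_const x (0 : ℂ)).congr_of_eventuallyEq
        (eventually_of_mem (Icc_mem_nhds (hx' hx).1 (hx' hx).2) hAB)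
    have e1 := d1.unique d2
    push_cast at e1
    have hPx : (P x : ℂ) ≠ 0 := Complex.ofReal_ne_zero.2 (hP x hx)
    have e2 : S.Y 0 x * A x + S.Y 1 x * B x = 0 := by
      refine (mul_eq_zero.1 ?_).resolve_left hPx
      linear_combination e1
    have e3 := hAB x hx
    have hW := S.wronskian_ofReal hx
    constructor
    · linear_combination (S.w * S.Y 1 x) * e3 - (S.w * S.y 1 x) * e2 - A x * hW
    · linear_combination (S.w * S.y 0 x) * e2 - (S.w * S.Y 0 x) * e3 - B x * hW
  have hA0 : Set.EqOn A 0 (Set.Icc a b) := Measure.eqOn_Icc_of_ae_eq (μ := volume) hab.ne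
    ((ae_restrict_iff' measurableSet_Icc).2 (hz.mono fun x h hx => (h hx).1)) hcA continuousOn_const
  have hB0 : Set.EqOn B 0 (Set.Icc a b) := Measure.eqOn_Icc_of_ae_eq (μ := volume) hab.ne
    ((ae_restrict_iff' measurableSet_Icc).2 (hz.mono fun x h hx => (h hx).2)) hcB continuousOn_const
  refine ⟨?_, ?_⟩
  · filter_upwards [hd, hae] with x hdx hx' hx
    obtain ⟨dA, dB⟩ := hdx hx
    have hn := Icc_mem_nhds (hx' hx).1 (hx' hx).2
    have e1 := dA.unique ((hasDerivAt_const x (0 : ℂ)).congr_of_eventuallyEq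
      (eventually_of_mem hn hA0))
    have e2 := dB.unique ((hasDerivAt_const x (0 : ℂ)).congr_of_eventuallyEq
      (eventually_of_mem hn hB0))
    linear_combination - G x * S.wronskian_ofReal hx - S.Y 1 x * e2 - S.Y 0 x * e1
  · have e0 : A a = 0 := hA0 (Set.left_mem_Icc.2 hab.le)
    have e1 : B b = 0 := hB0 (Set.right_mem_Icc.2 hab.le)
    simp only [A, B, intervalIntegral.integral_same, mul_zero, zero_add] at e0 e1
    ext j; fin_cases j
    · exact e0
    · exact e1

end Inhomogeneous

end GreenData

/-- The measure `r(t) dt` on the interval `[a, b]`, as a measure on the subtype. -/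
noncomputable def weightedMeasure (a b : ℝ) (r : ℝ → ℝ) : Measure (Set.Icc a b) :=
  Measure.comap Subtype.val
    ((volume.restrict (Set.Icc a b)).withDensity fun t => ENNReal.ofReal (r t))

section WeightedMeasure

variable {a b : ℝ} {r : ℝ → ℝ}

theorem map_weightedMeasure (a b : ℝ) (r : ℝ → ℝ) :
    (weightedMeasure a b r).map Subtype.val =
      (volume.restrict (Set.Icc a b)).withDensity fun t => ENNReal.ofReal (r t) := by
  rw [weightedMeasure, map_comap_subtype_coe measurableSet_Icc,
    restrict_withDensity measurableSet_Icc, Measure.restrict_restrict measurableSet_Icc,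
    Set.inter_self]

theorem isFiniteMeasure_weightedMeasure (hr : Continuous r) :
    IsFiniteMeasure (weightedMeasure a b r) := by
  have h1 : IsFiniteMeasure
      ((volume.restrict (Set.Icc a b)).withDensity fun t => ENNReal.ofReal (r t)) :=
    isFiniteMeasure_withDensity_ofReal (hr.continuousOn.integrableOn_compact isCompact_Icc).2
  refine ⟨?_⟩
  rw [weightedMeasure, comap_subtype_coe_apply measurableSet_Icc]
  exact measure_lt_top _ _

theorem ae_weightedMeasure_iff (hr : Continuous r) (hpos : ∀ t ∈ Set.Icc a b, 0 < r t)
    {p : ℝ → Prop} :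
    (∀ᵐ x : Set.Icc a b ∂weightedMeasure a b r, p x) ↔ ∀ᵐ t, t ∈ Set.Icc a b → p t := by
  rw [← (MeasurableEmbedding.subtype_coe measurableSet_Icc).ae_map_iff, map_weightedMeasure,
    ae_withDensity_iff (by fun_prop), ae_restrict_iff' measurableSet_Icc]
  refine eventually_congr (Eventually.of_forall fun t => ?_)
  refine forall_congr' fun ht => ?_
  simp [hpos t ht]

theorem integral_weightedMeasure (hr : Continuous r) (hpos : ∀ t ∈ Set.Icc a b, 0 < r t)
    (hab : a ≤ b) (f : ℝ → ℂ) :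
    ∫ x, f (x : ℝ) ∂weightedMeasure a b r = ∫ t in a..b, (r t : ℂ) * f t := by
  rw [← (MeasurableEmbedding.subtype_coe measurableSet_Icc).integral_map, map_weightedMeasure,
    integral_withDensity_eq_integral_toReal_smul (by fun_prop) (by simp),
    intervalIntegral.integral_of_le hab, ← integral_Icc_eq_integral_Ioc]
  refine setIntegral_congr_fun measurableSet_Icc fun t ht => ?_
  simp [ENNReal.toReal_ofReal (hpos t ht).le]

theorem intervalIntegrable_of_integrable_weightedMeasure (hr : Continuous r)
    (hpos : ∀ t ∈ Set.Icc a b, 0 < r t) (hab : a ≤ b) {f : ℝ → ℂ}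
    (hf : Integrable (fun x : Set.Icc a b => f x) (weightedMeasure a b r)) :
    IntervalIntegrable (fun t => (r t : ℂ) * f t) volume a b := by
  rw [intervalIntegrable_iff_integrableOn_Icc_of_le hab]
  change Integrable (f ∘ Subtype.val) _ at hf
  rw [← (MeasurableEmbedding.subtype_coe measurableSet_Icc).integrable_map_iff,
    map_weightedMeasure, integrable_withDensity_iff_integrable_smul' (by fun_prop) (by simp)] at hf
  refine IntegrableOn.congr_fun hf (fun t ht => ?_) measurableSet_Icc
  simp [ENNReal.toReal_ofReal (hpos t ht).le]

end WeightedMeasure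

namespace GreenData

variable {a b : ℝ} {P Q r : ℝ → ℝ} (S : GreenData a b P Q)

theorem exists_isCompactOperator_green (hab : a < b) (hr : Continuous r)
    (hpos : ∀ t ∈ Set.Icc a b, 0 < r t) :
    ∃ T : Lp ℂ 2 (weightedMeasure a b r) →L[ℂ] Lp ℂ 2 (weightedMeasure a b r),
      IsCompactOperator T ∧ (T : Lp ℂ 2 (weightedMeasure a b r) →ₗ[ℂ] _).IsSymmetric ∧
      ∀ g, T g =ᵐ[weightedMeasure a b r] fun x =>
        S.green (fun t => (r t : ℂ) * Set.IccExtend hab.le g t) x := by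
  have := isFiniteMeasure_weightedMeasure (a := a) (b := b) hr
  have hc : ∀ j, Continuous fun x : Set.Icc a b => S.y j x := fun j =>
    continuousOn_iff_continuous_domRestrict.1
      (show ContinuousOn (S.y j) (Set.Icc a b) from
        fun t ht => (S.hasDerivAt_y j t ht).continuousAt.continuousWithinAt)
  let k : C(Set.Icc a b × Set.Icc a b, ℝ) :=
    ⟨fun z => S.w * (S.y 0 (max z.1 z.2 : Set.Icc a b) * S.y 1 (min z.1 z.2 : Set.Icc a b)),
      continuous_const.mul (((hc 0).comp (continuous_fst.max continuous_snd)).mul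
        ((hc 1).comp (continuous_fst.min continuous_snd)))⟩
  obtain ⟨T, hT, hs, hTg⟩ := exists_isCompactOperator_integral (weightedMeasure a b r) k
    (fun x y => by simp only [k, ContinuousMap.coe_mk, max_comm, min_comm])
  refine ⟨T, hT, hs, fun g => (hTg g).trans (Eventually.of_forall fun x => ?_)⟩
  let G : ℝ → ℂ := fun t => (r t : ℂ) * Set.IccExtend hab.le g t
  have hgx : ∀ y : Set.Icc a b, Set.IccExtend hab.le g (y : ℝ) = g y :=
    fun y => Set.IccExtend_val _ _ _
  have hG : IntervalIntegrable G volume a b :=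
    intervalIntegrable_of_integrable_weightedMeasure hr hpos hab.le <| by
      simp only [hgx]
      exact (Lp.memLp g).integrable (by norm_num)
  have hi := fun j => S.intervalIntegrable_y_mul hab.le j hG
  have hxa : Set.uIcc a (x : ℝ) ⊆ Set.uIcc a b := by
    rw [Set.uIcc_of_le hab.le]
    exact Set.uIcc_subset_Icc (Set.left_mem_Icc.2 hab.le) x.2
  have hxb : Set.uIcc (x : ℝ) b ⊆ Set.uIcc a b := by
    rw [Set.uIcc_of_le hab.le]
    exact Set.uIcc_subset_Icc x.2 (Set.right_mem_Icc.2 hab.le)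
  let K : ℝ → ℂ := fun t => S.w * (S.y 0 (max (x : ℝ) t) * S.y 1 (min (x : ℝ) t)) *
    Set.IccExtend hab.le g t
  have e1 : ∀ t ∈ Set.uIcc a (x : ℝ),
      (S.w * S.y 0 x : ℂ) * ((S.y 1 t : ℂ) * G t) = r t * K t := fun t ht => by
    rw [Set.uIcc_of_le x.2.1] at ht
    simp only [K, G, max_eq_left ht.2, min_eq_right ht.2]
    ring
  have e2 : ∀ t ∈ Set.uIcc (x : ℝ) b,
      (S.w * S.y 1 x : ℂ) * ((S.y 0 t : ℂ) * G t) = r t * K t := fun t ht => by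
    rw [Set.uIcc_of_le x.2.2] at ht
    simp only [K, G, max_eq_right ht.1, min_eq_left ht.1]
    ring
  have i1 : IntervalIntegrable (fun t => (r t : ℂ) * K t) volume a x :=
    (((hi 1).mono_set hxa).const_mul (S.w * S.y 0 x : ℂ)).congr
      (fun t ht => e1 t (Set.uIoc_subset_uIcc ht))
  have i2 : IntervalIntegrable (fun t => (r t : ℂ) * K t) volume x b :=
    (((hi 0).mono_set hxb).const_mul (S.w * S.y 1 x : ℂ)).congr
      (fun t ht => e2 t (Set.uIoc_subset_uIcc ht))
  calc ∫ y, (k (x, y) : ℂ) * g y ∂weightedMeasure a b r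
      = ∫ y, K (y : ℝ) ∂weightedMeasure a b r := by
        refine integral_congr_ae (Eventually.of_forall fun y => ?_)
        simp [K, k, hgx]
    _ = ∫ t in a..b, (r t : ℂ) * K t := integral_weightedMeasure hr hpos hab.le K
    _ = (∫ t in a..x, (r t : ℂ) * K t) + ∫ t in x..b, (r t : ℂ) * K t :=
        (intervalIntegral.integral_add_adjacent_intervals i1 i2).symm
    _ = S.green G x := by
        rw [← intervalIntegral.integral_congr e1, ← intervalIntegral.integral_congr e2,
          intervalIntegral.integral_const_mul, intervalIntegral.integral_const_mul, green]
        ring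

end GreenData

theorem exists_greenData {P Q : ℝ → ℝ} (hP : Continuous P) (hQ : Continuous Q) {a b : ℝ}
    (hab : a < b) (hP0 : ∀ t ∈ Set.Icc a b, P t ≠ 0) {α β : Fin 2 → ℝ}
    (hαβ : α 0 ≠ 0 ∨ β 0 ≠ 0) :
    (∃ S : GreenData a b P Q, S.w ≠ 0 ∧ S.w * S.y 1 a = -β 0 ∧ S.w * S.Y 1 a = -α 0 ∧
      S.w * S.y 0 b = β 1 ∧ S.w * S.Y 0 b = α 1 ∧
      α 0 * S.y 0 a - β 0 * S.Y 0 a = -1 ∧ α 1 * S.y 1 b - β 1 * S.Y 1 b = -1) ∨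
    ∃ θ Θ : ℝ → ℝ, (∀ t ∈ Set.Icc a b, HasDerivAt θ (P t * Θ t) t ∧ HasDerivAt Θ (Q t * θ t) t) ∧
      (∃ t ∈ Set.Icc a b, θ t ≠ 0) ∧ α 0 * θ a - β 0 * Θ a = 0 ∧ α 1 * θ b - β 1 * Θ b = 0 := by
  have ha : a ∈ Set.Icc a b := Set.left_mem_Icc.2 hab.le
  have hb : b ∈ Set.Icc a b := Set.right_mem_Icc.2 hab.le
  obtain ⟨u, U, v, V, hd, hW⟩ := exists_fundamental_system hP hQ hab.le
  have hsol : ∀ t₀ ∈ Set.Icc a b, ∀ x y : ℝ, ∃ θ Θ : ℝ → ℝ, θ t₀ = x ∧ Θ t₀ = y ∧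
      ∀ t ∈ Set.Icc a b, HasDerivAt θ (P t * Θ t) t ∧ HasDerivAt Θ (Q t * θ t) t := by
    intro t₀ ht₀ x y
    let k := x * V t₀ - y * v t₀
    let l := y * u t₀ - x * U t₀
    refine ⟨fun t => k * u t + l * v t, fun t => k * U t + l * V t, ?_, ?_, fun t ht => ?_⟩
    · simp only [k, l]; linear_combination x * hW t₀ ht₀
    · simp only [k, l]; linear_combination y * hW t₀ ht₀
    · obtain ⟨h1, h2, h3, h4⟩ := hd t ht
      exact ⟨((h1.const_mul k).add (h3.const_mul l)).congr_deriv (by ring),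
        ((h2.const_mul k).add (h4.const_mul l)).congr_deriv (by ring)⟩
  obtain ⟨θ, Θ, hθa, hΘa, hθ⟩ := hsol a ha (β 0) (α 0)
  obtain ⟨η, H, hηb, hHb, hη⟩ := hsol b hb (β 1) (α 1)
  have hW' : ∀ t ∈ Set.Icc a b,
      HasDerivWithinAt (fun t => θ t * H t - Θ t * η t) 0 (Set.Icc a b) t := fun t ht =>
    (((hθ t ht).1.mul (hη t ht).2).sub
      ((hθ t ht).2.mul (hη t ht).1)).hasDerivWithinAt.congr_deriv (by ring)
  have hconst := constant_of_has_deriv_right_zero (fun t ht => (hW' t ht).continuousWithinAt)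
    (fun t ht => (hW' t (Set.Ico_subset_Icc_self ht)).mono_of_mem_nhdsWithin
      (Icc_mem_nhdsGE_of_mem ht))
  set w := θ a * H a - Θ a * η a with hw
  have hwb := hconst b hb
  rw [hηb, hHb] at hwb
  by_cases hw0 : w = 0
  · refine Or.inr ⟨θ, Θ, hθ, ?_, by rw [hθa, hΘa]; ring, by linear_combination hwb + hw0⟩
    by_contra! h0
    have hΘ0 : Θ a = 0 := by
      have e1 := (hθ a ha).1.hasDerivWithinAt (s := Set.Icc a b)
      have e2 : HasDerivWithinAt θ 0 (Set.Icc a b) a :=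
        (hasDerivWithinAt_const a _ (0 : ℝ)).congr h0 (h0 a ha)
      exact (mul_eq_zero.1 ((uniqueDiffOn_Icc hab a ha).eq_deriv _ e1 e2)).resolve_left (hP0 a ha)
    rw [h0 a ha] at hθa
    rw [hΘ0] at hΘa
    exact hαβ.elim (fun h => h hΘa.symm) fun h => h hθa.symm
  · refine Or.inl ⟨⟨![fun t => w⁻¹ * η t, fun t => -(w⁻¹ * θ t)],
      ![fun t => w⁻¹ * H t, fun t => -(w⁻¹ * Θ t)], w, ?_, ?_, ?_⟩, hw0, ?_, ?_, ?_, ?_, ?_, ?_⟩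
    · intro j t ht
      fin_cases j
      · exact ((hη t ht).1.const_mul w⁻¹).congr_deriv (mul_left_comm _ _ _)
      · refine ((hθ t ht).1.const_mul w⁻¹).neg.congr_deriv ?_
        change _ = P t * -(w⁻¹ * Θ t)
        ring
    · intro j t ht
      fin_cases j
      · exact ((hη t ht).2.const_mul w⁻¹).congr_deriv (mul_left_comm _ _ _)
      · refine ((hθ t ht).2.const_mul w⁻¹).neg.congr_deriv ?_
        change _ = Q t * -(w⁻¹ * θ t)
        ring
    · intro t ht
      change w * (w⁻¹ * η t * -(w⁻¹ * Θ t) - w⁻¹ * H t * -(w⁻¹ * θ t)) = 1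
      have := hconst t ht
      field_simp
      linear_combination this
    · change w * -(w⁻¹ * θ a) = _
      rw [hθa]; field_simp
    · change w * -(w⁻¹ * Θ a) = _
      rw [hΘa]; field_simp
    · change w * (w⁻¹ * η b) = _
      rw [hηb]; field_simp
    · change w * (w⁻¹ * H b) = _
      rw [hHb]; field_simp
    · change α 0 * (w⁻¹ * η a) - β 0 * (w⁻¹ * H a) = -1
      rw [hθa, hΘa] at hw
      field_simp
      linear_combination hw
    · change α 1 * -(w⁻¹ * θ b) - β 1 * -(w⁻¹ * Θ b) = -1
      field_simp
      linear_combination -hwb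

namespace SLP

variable (P : SLP)

/-- The function `1 / p` on `[z1, z2]`, extended by constants. -/
noncomputable def pinv (t : ℝ) : ℝ := (P.p (Set.projIcc P.z1 P.z2 P.hz.le t))⁻¹

theorem continuous_pinv : Continuous P.pinv :=
  (P.hp.continuous.comp (continuous_subtype_val.comp continuous_projIcc)).inv₀
    fun t => (P.hppos _ (Set.projIcc P.z1 P.z2 P.hz.le t).2).ne'

theorem pinv_eq {t : ℝ} (ht : t ∈ Set.Icc P.z1 P.z2) : P.pinv t = (P.p t)⁻¹ := by
  rw [pinv, Set.projIcc_of_mem P.hz.le ht]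

theorem pinv_ne_zero {t : ℝ} (ht : t ∈ Set.Icc P.z1 P.z2) : P.pinv t ≠ 0 := by
  rw [P.pinv_eq ht]
  exact inv_ne_zero (P.hppos t ht).ne'

theorem pinv_mul_p {t : ℝ} (ht : t ∈ Set.Icc P.z1 P.z2) (x : ℂ) :
    (P.pinv t : ℂ) * (P.p t * x) = x := by
  have := Complex.ofReal_ne_zero.2 (P.hppos t ht).ne'
  rw [P.pinv_eq ht]
  push_cast
  field_simp

/-- The quasi-derivative `p φ'`. -/
noncomputable def quasiDeriv (φ : ℝ → ℂ) (t : ℝ) : ℂ := P.p t * deriv φ t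

variable {P} in
theorem IsEigenpair.hasDerivAt {lam : ℂ} {φ : ℝ → ℂ} (h : P.IsEigenpair lam φ) {t : ℝ}
    (ht : t ∈ Set.Icc P.z1 P.z2) :
    HasDerivAt φ (P.pinv t * P.quasiDeriv φ t) t ∧
      HasDerivAt (P.quasiDeriv φ) ((P.q t - lam * P.r t) * φ t) t := by
  obtain ⟨hφ, -, hode, -⟩ := h
  have e2 : (2 : WithTop ℕ∞) = 1 + 1 := by norm_num
  have hd1 : ContDiff ℝ 1 (deriv φ) := by
    rw [e2, contDiff_succ_iff_deriv] at hφ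
    exact hφ.2.2
  have hp1 : ContDiff ℝ 1 fun t => (P.p t : ℂ) :=
    Complex.ofRealCLM.contDiff.comp (P.hp.of_le (by norm_num))
  have hqd : ContDiff ℝ 1 (P.quasiDeriv φ) := hp1.mul hd1
  refine ⟨?_, ?_⟩
  · rw [quasiDeriv, P.pinv_mul_p ht]
    exact (hφ.differentiable (by norm_num) t).hasDerivAt
  · refine ((hqd.differentiable (by norm_num) t).hasDerivAt).congr_deriv ?_
    have hc1 : Continuous (deriv (P.quasiDeriv φ)) := hqd.continuous_deriv le_rfl
    have hc2 : Continuous fun t => ((P.q t - lam * P.r t) * φ t : ℂ) := by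
      have := P.hq
      have := P.hr.continuous
      have := hφ.continuous
      fun_prop
    have heq : Set.EqOn (deriv (P.quasiDeriv φ)) (fun t => ((P.q t - lam * P.r t) * φ t : ℂ))
        (closure (Set.Ioo P.z1 P.z2)) :=
      Set.EqOn.closure (fun x hx => by
        have := hode x hx
        change -(deriv (P.quasiDeriv φ) x) + _ = _ at this
        linear_combination -this) hc1 hc2
    rw [closure_Ioo P.hz.ne] at heq
    exact heq ht

/-- Solutions of the first order system on `[z1, z2]` extend to eigen-solutions. -/
theorem exists_isEigenpair {lam : ℂ} {f F : ℝ → ℂ}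
    (hf : ∀ t ∈ Set.Icc P.z1 P.z2,
      HasDerivWithinAt f (P.pinv t * F t) (Set.Icc P.z1 P.z2) t)
    (hF : ∀ t ∈ Set.Icc P.z1 P.z2,
      HasDerivWithinAt F ((P.q t - lam * P.r t) * f t) (Set.Icc P.z1 P.z2) t)
    (h0 : ∃ t ∈ Set.Icc P.z1 P.z2, f t ≠ 0)
    (hbc : ∀ j, -(P.a j * f (P.zb j) - P.b j * F (P.zb j))
      = lam * (P.c j * f (P.zb j) - P.d j * F (P.zb j))) :
    ∃ φ, P.IsEigenpair lam φ ∧ ∀ t ∈ Set.Icc P.z1 P.z2, φ t = f t ∧ P.quasiDeriv φ t = F t := by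
  have hpc : ∀ t, HasDerivAt (fun t => (P.p t : ℂ)) (deriv P.p t : ℝ) t := fun t =>
    ((P.hp.differentiable (by norm_num) t).hasDerivAt).ofReal_comp
  have hp0 : ∀ t ∈ Set.Icc P.z1 P.z2, (P.p t : ℂ) ≠ 0 := fun t ht =>
    Complex.ofReal_ne_zero.2 (P.hppos t ht).ne'
  have hf1 : ∀ t ∈ Set.Icc P.z1 P.z2,
      HasDerivWithinAt f (F t / P.p t) (Set.Icc P.z1 P.z2) t := fun t ht =>
    (hf t ht).congr_deriv (by rw [P.pinv_eq ht]; push_cast; field_simp)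
  have hf2 := fun t ht => (hF t ht).div (hpc t).hasDerivWithinAt (hp0 t ht)
  have hfc : ContinuousOn f (Set.Icc P.z1 P.z2) := fun t ht => (hf t ht).continuousWithinAt
  have hFc : ContinuousOn F (Set.Icc P.z1 P.z2) := fun t ht => (hF t ht).continuousWithinAt
  have hpcont : Continuous fun t => (P.p t : ℂ) := Complex.continuous_ofReal.comp P.hp.continuous
  have hqc : Continuous fun t => (P.q t - lam * P.r t : ℂ) := by
    have := P.hq
    have := P.hr.continuous
    fun_prop
  have hp'c : Continuous fun t => ((deriv P.p t : ℝ) : ℂ) :=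
    Complex.continuous_ofReal.comp (P.hp.continuous_deriv (by norm_num))
  obtain ⟨φ, hφ, hφf⟩ := exists_contDiff_two_extension P.hz.le hf1 hf2
    ((((hqc.continuousOn.mul hfc).mul hpcont.continuousOn).sub
      (hFc.mul hp'c.continuousOn)).div (hpcont.pow 2).continuousOn
        fun t ht => pow_ne_zero 2 (hp0 t ht))
  have hφF : ∀ t ∈ Set.Icc P.z1 P.z2, P.quasiDeriv φ t = F t := fun t ht => by
    rw [quasiDeriv, (hφf t ht).2, mul_div_cancel₀ _ (hp0 t ht)]
  have hzb : ∀ j, P.zb j ∈ Set.Icc P.z1 P.z2 := fun j => by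
    fin_cases j
    · exact Set.left_mem_Icc.2 P.hz.le
    · exact Set.right_mem_Icc.2 P.hz.le
  refine ⟨φ, ⟨hφ, ?_, fun z hz => ?_, fun j => ?_⟩, fun t ht => ⟨(hφf t ht).1, hφF t ht⟩⟩
  · obtain ⟨t, ht, h0⟩ := h0
    exact ⟨t, ht, by rwa [(hφf t ht).1]⟩
  · have hz' := Set.Ioo_subset_Icc_self hz
    have hn := Icc_mem_nhds hz.1 hz.2
    have h1 : HasDerivAt (P.quasiDeriv φ) ((P.q z - lam * P.r z) * f z) z :=
      ((hF z hz').hasDerivAt hn).congr_of_eventuallyEq (eventually_of_mem hn hφF)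
    change -(deriv (P.quasiDeriv φ) z) + _ = _
    rw [h1.deriv, (hφf z hz').1]
    ring
  · change -(_ - P.b j * P.quasiDeriv φ (P.zb j)) = lam * (_ - P.d j * P.quasiDeriv φ (P.zb j))
    rw [(hφf _ (hzb j)).1, hφF _ (hzb j)]
    exact hbc j

end SLP

/-- A solution of a linear first order system vanishing at a point vanishes identically. -/
theorem eq_zero_of_linear_system {P Q : ℝ → ℝ} (hP : Continuous P) (hQ : Continuous Q) {a b : ℝ}
    {f F : ℝ → ℂ} (hf : ∀ t ∈ Set.Icc a b, HasDerivAt f (P t * F t) t)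
    (hF : ∀ t ∈ Set.Icc a b, HasDerivAt F (Q t * f t) t) {x : ℝ} (hx : x ∈ Set.Icc a b)
    (hfx : f x = 0) (hFx : F x = 0) : ∀ t ∈ Set.Icc a b, f t = 0 ∧ F t = 0 := by
  have hab := hx.1.trans hx.2
  obtain ⟨u, U, v, V, hd, hW⟩ := exists_fundamental_system hP hQ hab
  have key : ∀ y Y : ℝ → ℝ, (∀ t ∈ Set.Icc a b, HasDerivAt y (P t * Y t) t ∧
      HasDerivAt Y (Q t * y t) t) → ∀ t ∈ Set.Icc a b, (y t * F t - Y t * f t : ℂ) = 0 := by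
    intro y Y h
    have h' : ∀ t ∈ Set.Icc a b,
        HasDerivWithinAt (fun t => (y t * F t - Y t * f t : ℂ)) 0 (Set.Icc a b) t := fun t ht => by
      refine (((h t ht).1.ofReal_comp.mul (hF t ht)).sub
        ((h t ht).2.ofReal_comp.mul (hf t ht))).hasDerivWithinAt.congr_deriv ?_
      push_cast
      ring
    have hconst := constant_of_has_deriv_right_zero (fun t ht => (h' t ht).continuousWithinAt)
      (fun t ht => (h' t (Set.Ico_subset_Icc_self ht)).mono_of_mem_nhdsWithin
        (Icc_mem_nhdsGE_of_mem ht))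
    intro t ht
    rw [hconst t ht, ← hconst x hx, hfx, hFx]
    ring
  intro t ht
  have h1 := key u U (fun t ht => ⟨(hd t ht).1, (hd t ht).2.1⟩) t ht
  have h2 := key v V (fun t ht => (hd t ht).2.2) t ht
  have h3 : (u t * V t - U t * v t : ℂ) = 1 := by exact_mod_cast hW t ht
  exact ⟨by linear_combination -f t * h3 + v t * h1 - u t * h2,
    by linear_combination -F t * h3 + V t * h1 - U t * h2⟩

theorem GreenData.green_const_mul {a b : ℝ} {P Q : ℝ → ℝ} (S : GreenData a b P Q) (k : ℂ)
    (G : ℝ → ℂ) (x : ℝ) : S.green (fun t => k * G t) x = k * S.green G x := by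
  simp only [green, mul_left_comm _ k, intervalIntegral.integral_const_mul]
  ring

namespace SLP

variable (P : SLP)

theorem zb_mem (j : Fin 2) : P.zb j ∈ Set.Icc P.z1 P.z2 := by
  fin_cases j
  · exact Set.left_mem_Icc.2 P.hz.le
  · exact Set.right_mem_Icc.2 P.hz.le

theorem D_zero : P.D 0 = P.a 0 * P.d 0 - P.b 0 * P.c 0 := by simp [D, sgn]

theorem D_one : P.D 1 = -(P.a 1 * P.d 1 - P.b 1 * P.c 1) := by simp [D, sgn]

theorem Bop_eq (j : Fin 2) (φ : ℝ → ℂ) :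
    P.Bop j φ = P.a j * φ (P.zb j) - P.b j * P.quasiDeriv φ (P.zb j) := rfl

theorem Cop_eq (j : Fin 2) (φ : ℝ → ℂ) :
    P.Cop j φ = P.c j * φ (P.zb j) - P.d j * P.quasiDeriv φ (P.zb j) := rfl

theorem cross_ne_zero_of_D_ne_zero {j : Fin 2} (h : P.D j ≠ 0) :
    P.a j * P.d j - P.b j * P.c j ≠ 0 := fun h0 => h (by rw [D, h0, mul_zero])

/-- The boundary coefficients at a spectral parameter do not vanish simultaneously. -/
theorem shifted_ne_zero (hcd : ∀ j, P.D j = 0 → P.c j = 0 ∧ P.d j = 0) (s : ℝ) (j : Fin 2) :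
    P.a j + s * P.c j ≠ 0 ∨ P.b j + s * P.d j ≠ 0 := by
  by_contra! h
  by_cases hD : P.D j = 0
  · obtain ⟨hc, hd⟩ := hcd j hD
    refine P.hab j (Prod.ext ?_ ?_)
    · simpa [hc] using h.1
    · simpa [hd] using h.2
  · exact P.cross_ne_zero_of_D_ne_zero hD (by linear_combination P.d j * h.1 - P.c j * h.2)

theorem continuous_potential (s : ℝ) : Continuous fun t => P.q t - s * P.r t := by
  have := P.hq
  have := P.hr.continuous
  fun_prop

/-- An eigen-solution and its quasi-derivative have no common zero. -/
theorem IsEigenpair.not_eq_zero_and_eq_zero {P : SLP} {lam : ℝ} {φ : ℝ → ℂ}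
    (h : P.IsEigenpair lam φ) {x : ℝ} (hx : x ∈ Set.Icc P.z1 P.z2) :
    ¬ (φ x = 0 ∧ P.quasiDeriv φ x = 0) := fun h0 => by
  obtain ⟨t, ht, hφt⟩ := h.2.1
  exact hφt (eq_zero_of_linear_system (F := P.quasiDeriv φ) P.continuous_pinv
    (P.continuous_potential lam) (fun t ht => (h.hasDerivAt ht).1)
    (fun t ht => (h.hasDerivAt ht).2.congr_deriv (by push_cast; ring)) hx h0.1 h0.2 t ht).1

/-- Eigen-solutions with the same eigenvalue are proportional. -/
theorem IsEigenpair.exists_eq_mul {P : SLP} {lam : ℝ} {φ f : ℝ → ℂ} (hφ : P.IsEigenpair lam φ)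
    (hf : P.IsEigenpair lam f) {i : Fin 2}
    (hi : P.a i + lam * P.c i ≠ 0 ∨ P.b i + lam * P.d i ≠ 0) :
    ∃ k : ℂ, ∀ t ∈ Set.Icc P.z1 P.z2,
      f t = k * φ t ∧ P.quasiDeriv f t = k * P.quasiDeriv φ t := by
  have hd1 := fun t ht => hφ.hasDerivAt (t := t) ht
  have hd2 := fun t ht => hf.hasDerivAt (t := t) ht
  have hz := P.zb_mem i
  have hφ0 := hφ.not_eq_zero_and_eq_zero hz
  have e1 := hφ.2.2.2 i
  have e2 := hf.2.2.2 i
  rw [Bop_eq, Cop_eq] at e1 e2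
  have hW : φ (P.zb i) * P.quasiDeriv f (P.zb i) - P.quasiDeriv φ (P.zb i) * f (P.zb i) = 0 := by
    rcases hi with hi | hi
    · refine (mul_eq_zero.1 ?_).resolve_left (Complex.ofReal_ne_zero.2 hi)
      push_cast
      linear_combination -P.quasiDeriv f (P.zb i) * e1 + P.quasiDeriv φ (P.zb i) * e2
    · refine (mul_eq_zero.1 ?_).resolve_left (Complex.ofReal_ne_zero.2 hi)
      push_cast
      linear_combination φ (P.zb i) * e2 - f (P.zb i) * e1
  obtain ⟨k, hk1, hk2⟩ : ∃ k : ℂ, f (P.zb i) = k * φ (P.zb i) ∧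
      P.quasiDeriv f (P.zb i) = k * P.quasiDeriv φ (P.zb i) := by
    by_cases h0 : φ (P.zb i) = 0
    · have h1 : P.quasiDeriv φ (P.zb i) ≠ 0 := fun h => hφ0 ⟨h0, h⟩
      refine ⟨P.quasiDeriv f (P.zb i) / P.quasiDeriv φ (P.zb i), ?_, by field_simp⟩
      field_simp
      linear_combination -hW
    · refine ⟨f (P.zb i) / φ (P.zb i), by field_simp, ?_⟩
      field_simp
      linear_combination hW
  refine ⟨k, fun t ht => ?_⟩
  have := eq_zero_of_linear_system (f := fun t => f t - k * φ t)
    (F := fun t => P.quasiDeriv f t - k * P.quasiDeriv φ t) P.continuous_pinv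
    (P.continuous_potential lam)
    (fun t ht => ((hd2 t ht).1.sub ((hd1 t ht).1.const_mul k)).congr_deriv (by ring))
    (fun t ht => ((hd2 t ht).2.sub ((hd1 t ht).2.const_mul k)).congr_deriv (by push_cast; ring))
    hz (by rw [hk1]; ring) (by rw [hk2]; ring) t ht
  exact ⟨sub_eq_zero.1 this.1, sub_eq_zero.1 this.2⟩

/-- Green data adapted to the boundary conditions at the spectral parameter `s`. -/
structure IsAdapted {s : ℝ} (S : GreenData P.z1 P.z2 P.pinv fun t => P.q t - s * P.r t) :
    Prop where
  w_ne : S.w ≠ 0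
  y_left : S.w * S.y 1 P.z1 = -(P.b 0 + s * P.d 0)
  Y_left : S.w * S.Y 1 P.z1 = -(P.a 0 + s * P.c 0)
  y_right : S.w * S.y 0 P.z2 = P.b 1 + s * P.d 1
  Y_right : S.w * S.Y 0 P.z2 = P.a 1 + s * P.c 1
  left : (P.a 0 + s * P.c 0) * S.y 0 P.z1 - (P.b 0 + s * P.d 0) * S.Y 0 P.z1 = -1
  right : (P.a 1 + s * P.c 1) * S.y 1 P.z2 - (P.b 1 + s * P.d 1) * S.Y 1 P.z2 = -1

theorem exists_isAdapted (hcd : ∀ j, P.D j = 0 → P.c j = 0 ∧ P.d j = 0) {s : ℝ}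
    (hs : ¬ P.IsEigenvalue s) :
    ∃ S : GreenData P.z1 P.z2 P.pinv fun t => P.q t - s * P.r t, P.IsAdapted S := by
  rcases exists_greenData P.continuous_pinv (P.continuous_potential s) P.hz (fun t ht => P.pinv_ne_zero ht)
    (α := fun j => P.a j + s * P.c j) (β := fun j => P.b j + s * P.d j)
    (P.shifted_ne_zero hcd s 0) with ⟨S, h1, h2, h3, h4, h5, h6, h7⟩ | ⟨θ, Θ, h1, ⟨t, ht, h2⟩, h3, h4⟩
  · exact ⟨S, h1, h2, h3, h4, h5, h6, h7⟩
  · refine absurd ?_ hs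
    obtain ⟨φ, hφ, -⟩ := P.exists_isEigenpair (lam := s) (f := fun t => θ t) (F := fun t => Θ t)
      (fun t ht => (h1 t ht).1.ofReal_comp.hasDerivWithinAt.congr_deriv (by push_cast; ring))
      (fun t ht => (h1 t ht).2.ofReal_comp.hasDerivWithinAt.congr_deriv (by push_cast; ring))
      ⟨t, ht, Complex.ofReal_ne_zero.2 h2⟩ (fun j => by
        fin_cases j
        · change -((P.a 0 : ℂ) * θ P.z1 - P.b 0 * Θ P.z1) = s * (P.c 0 * θ P.z1 - P.d 0 * Θ P.z1)
          norm_cast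
          linear_combination -h3
        · change -((P.a 1 : ℂ) * θ P.z2 - P.b 1 * Θ P.z2) = s * (P.c 1 * θ P.z2 - P.d 1 * Θ P.z2)
          norm_cast
          linear_combination -h4)
    exact ⟨φ, hφ⟩

section Adapted

variable {P} {s : ℝ} {S : GreenData P.z1 P.z2 P.pinv fun t => P.q t - s * P.r t}

/-- The boundary functional `C_j` applied to the fundamental solution `y k`. -/
def bdry (S : GreenData P.z1 P.z2 P.pinv fun t => P.q t - s * P.r t) (j k : Fin 2) : ℝ :=
  P.c j * S.y k (P.zb j) - P.d j * S.Y k (P.zb j)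

theorem IsAdapted.w_mul_bdry_zero_one (hS : P.IsAdapted S) : S.w * bdry S 0 1 = P.D 0 := by
  change S.w * (P.c 0 * S.y 1 P.z1 - P.d 0 * S.Y 1 P.z1) = _
  rw [D_zero]
  linear_combination P.c 0 * hS.y_left - P.d 0 * hS.Y_left

theorem IsAdapted.w_mul_bdry_one_zero (hS : P.IsAdapted S) : S.w * bdry S 1 0 = P.D 1 := by
  change S.w * (P.c 1 * S.y 0 P.z2 - P.d 1 * S.Y 0 P.z2) = _
  rw [D_one]
  linear_combination P.c 1 * hS.y_right - P.d 1 * hS.Y_right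

theorem IsAdapted.inv_D_mul_bdry (hS : P.IsAdapted S) {j k : Fin 2} (hj : P.D j ≠ 0)
    (hk : P.D k ≠ 0) : (P.D j)⁻¹ * bdry S j k = (P.D k)⁻¹ * bdry S k j := by
  have hw := hS.w_ne
  have h1 := hS.w_mul_bdry_zero_one
  have h2 := hS.w_mul_bdry_one_zero
  have h3 : P.D 0 ≠ 0 → P.D 1 ≠ 0 → (P.D 0)⁻¹ * bdry S 0 1 = (P.D 1)⁻¹ * bdry S 1 0 := by
    intro h0 h0'
    field_simp
    apply mul_left_cancel₀ hw
    linear_combination P.D 1 * h1 - P.D 0 * h2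
  fin_cases j <;> fin_cases k
  · rfl
  · exact h3 hj hk
  · exact (h3 hk hj).symm
  · rfl

end Adapted

end SLP

namespace SLP

variable {P : SLP} {s : ℝ} {S : GreenData P.z1 P.z2 P.pinv fun t => P.q t - s * P.r t}

section Direct

variable {κ : ℂ} {f F : ℝ → ℂ} {C : Fin 2 → ℂ}
  (hf : ∀ t ∈ Set.Icc P.z1 P.z2, HasDerivAt f (P.pinv t * F t) t)
  (hF : ∀ t ∈ Set.Icc P.z1 P.z2,
    HasDerivAt F ((P.q t - s * P.r t : ℝ) * f t - κ * (P.r t * f t)) t)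
  (hC : ∀ j, P.c j * f (P.zb j) - P.d j * F (P.zb j) = C j)
  (hbc : ∀ j, (P.a j + s * P.c j) * f (P.zb j) - (P.b j + s * P.d j) * F (P.zb j) = -κ * C j)

include hf in
theorem continuousOn_mul_weight : ContinuousOn (fun t => κ * (P.r t * f t)) (Set.Icc P.z1 P.z2) :=
  continuousOn_const.mul ((Complex.continuous_ofReal.comp P.hr.continuous).continuousOn.mul
    fun t ht => (hf t ht).continuousAt.continuousWithinAt)

include hf hF hbc in
theorem IsAdapted.mul_green_eq (hS : P.IsAdapted S) {x : ℝ} (hx : x ∈ Set.Icc P.z1 P.z2) :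
    κ * (S.green (fun t => P.r t * f t) x + (C 0 * S.y 0 x + C 1 * S.y 1 x)) = f x := by
  have h1 := S.green_eq hf hF (continuousOn_mul_weight hf) hx
  rw [S.green_const_mul] at h1
  have b0 := hbc 0
  have b1 := hbc 1
  change _ * f P.z1 - _ * F P.z1 = _ at b0
  change _ * f P.z2 - _ * F P.z2 = _ at b1
  have e1 : (S.w * S.y 1 P.z1 : ℂ) = -(P.b 0 + s * P.d 0) := by exact_mod_cast hS.y_left
  have e2 : (S.w * S.Y 1 P.z1 : ℂ) = -(P.a 0 + s * P.c 0) := by exact_mod_cast hS.Y_left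
  have e3 : (S.w * S.y 0 P.z2 : ℂ) = P.b 1 + s * P.d 1 := by exact_mod_cast hS.y_right
  have e4 : (S.w * S.Y 0 P.z2 : ℂ) = P.a 1 + s * P.c 1 := by exact_mod_cast hS.Y_right
  linear_combination h1 + S.y 0 x * (F P.z1 * e1 - f P.z1 * e2 + b0)
    - S.y 1 x * (F P.z2 * e3 - f P.z2 * e4 - b1)

include hf hF hC hbc in
theorem IsAdapted.mul_integral_eq (hS : P.IsAdapted S) (j : Fin 2) :
    κ * (P.D j * (∫ t in P.z1..P.z2, (S.y j t : ℂ) * (P.r t * f t)) +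
      (bdry S j 0 * C 0 + bdry S j 1 * C 1)) = C j := by
  have h1 := S.integral_y_mul_eq hf hF (continuousOn_mul_weight hf) j
    (Set.left_mem_Icc.2 P.hz.le) (Set.right_mem_Icc.2 P.hz.le)
  simp only [mul_left_comm _ κ, intervalIntegral.integral_const_mul] at h1
  have b0 := hbc 0
  have b1 := hbc 1
  have c0 := hC 0
  have c1 := hC 1
  change _ * f P.z1 - _ * F P.z1 = _ at b0 c0
  change _ * f P.z2 - _ * F P.z2 = _ at b1 c1
  have e1 : (S.w * S.y 1 P.z1 : ℂ) = -(P.b 0 + s * P.d 0) := by exact_mod_cast hS.y_left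
  have e2 : (S.w * S.Y 1 P.z1 : ℂ) = -(P.a 0 + s * P.c 0) := by exact_mod_cast hS.Y_left
  have e3 : (S.w * S.y 0 P.z2 : ℂ) = P.b 1 + s * P.d 1 := by exact_mod_cast hS.y_right
  have e4 : (S.w * S.Y 0 P.z2 : ℂ) = P.a 1 + s * P.c 1 := by exact_mod_cast hS.Y_right
  have e5 : ((P.a 0 + s * P.c 0) * S.y 0 P.z1 - (P.b 0 + s * P.d 0) * S.Y 0 P.z1 : ℂ) = -1 := by
    exact_mod_cast hS.left
  have e6 : ((P.a 1 + s * P.c 1) * S.y 1 P.z2 - (P.b 1 + s * P.d 1) * S.Y 1 P.z2 : ℂ) = -1 := by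
    exact_mod_cast hS.right
  have m01 : (S.w * bdry S 0 1 : ℂ) = P.D 0 := by exact_mod_cast hS.w_mul_bdry_zero_one
  have m10 : (S.w * bdry S 1 0 : ℂ) = P.D 1 := by exact_mod_cast hS.w_mul_bdry_one_zero
  have m00 : (bdry S 0 0 : ℂ) = P.c 0 * S.y 0 P.z1 - P.d 0 * S.Y 0 P.z1 := by
    exact_mod_cast (rfl : bdry S 0 0 = P.c 0 * S.y 0 P.z1 - P.d 0 * S.Y 0 P.z1)
  have m11 : (bdry S 1 1 : ℂ) = P.c 1 * S.y 1 P.z2 - P.d 1 * S.Y 1 P.z2 := by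
    exact_mod_cast (rfl : bdry S 1 1 = P.c 1 * S.y 1 P.z2 - P.d 1 * S.Y 1 P.z2)
  have d0 : (P.D 0 : ℂ) = P.a 0 * P.d 0 - P.b 0 * P.c 0 := by exact_mod_cast P.D_zero
  have d1 : (P.D 1 : ℂ) = -(P.a 1 * P.d 1 - P.b 1 * P.c 1) := by exact_mod_cast P.D_one
  have hw : (S.w : ℂ) ≠ 0 := Complex.ofReal_ne_zero.2 hS.w_ne
  fin_cases j
  · simp only [Fin.zero_eta] at h1 ⊢
    have k1 : (S.w : ℂ) * (S.y 0 P.z2 * F P.z2 - S.Y 0 P.z2 * f P.z2) = κ * C 1 := by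
      linear_combination F P.z2 * e3 - f P.z2 * e4 - b1
    have k2 : (P.D 0 : ℂ) * (S.y 0 P.z1 * F P.z1 - S.Y 0 P.z1 * f P.z1) + κ * bdry S 0 0 * C 0
        = C 0 := by
      rw [← c0] at b0 ⊢
      rw [m00, d0]
      linear_combination -(P.c 0 * f P.z1 - P.d 0 * F P.z1) * e5 +
        (P.c 0 * S.y 0 P.z1 - P.d 0 * S.Y 0 P.z1) * b0
    apply mul_left_cancel₀ hw
    linear_combination S.w * P.D 0 * h1 + S.w * k2 - P.D 0 * k1 + κ * C 1 * m01
  · simp only [Fin.mk_one] at h1 ⊢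
    have k1 : (S.w : ℂ) * (S.y 1 P.z1 * F P.z1 - S.Y 1 P.z1 * f P.z1) = -κ * C 0 := by
      linear_combination F P.z1 * e1 - f P.z1 * e2 + b0
    have k2 : -(P.D 1 : ℂ) * (S.y 1 P.z2 * F P.z2 - S.Y 1 P.z2 * f P.z2) + κ * bdry S 1 1 * C 1
        = C 1 := by
      rw [← c1] at b1 ⊢
      rw [m11, d1]
      linear_combination -(P.c 1 * f P.z2 - P.d 1 * F P.z2) * e6 +
        (P.c 1 * S.y 1 P.z2 - P.d 1 * S.Y 1 P.z2) * b1
    apply mul_left_cancel₀ hw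
    linear_combination S.w * P.D 1 * h1 + S.w * k2 + P.D 1 * k1 + κ * C 0 * m10

end Direct

/-- Solutions of the integral eigenvalue equation solve the boundary value problem. -/
theorem IsAdapted.boundary_of_green (hS : P.IsAdapted S)
    (hcd : ∀ j, P.D j = 0 → P.c j = 0 ∧ P.d j = 0) {κ : ℂ} {f F : ℝ → ℂ} {h : Fin 2 → ℂ}
    (hf : ∀ t ∈ Set.Icc P.z1 P.z2, f t =
      κ * (S.green (fun t => P.r t * f t) t + (h 0 * S.y 0 t + h 1 * S.y 1 t)))
    (hF : ∀ t ∈ Set.Icc P.z1 P.z2, F t =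
      κ * (S.greenDeriv (fun t => P.r t * f t) t + (h 0 * S.Y 0 t + h 1 * S.Y 1 t)))
    (hh : ∀ j, P.D j = 0 → h j = 0)
    (hI : ∀ j, P.D j ≠ 0 → κ * (P.D j * (∫ t in P.z1..P.z2, (S.y j t : ℂ) * (P.r t * f t)) +
      (bdry S j 0 * h 0 + bdry S j 1 * h 1)) = h j) (j : Fin 2) :
    P.c j * f (P.zb j) - P.d j * F (P.zb j) = h j ∧
      (P.a j + s * P.c j) * f (P.zb j) - (P.b j + s * P.d j) * F (P.zb j) = -κ * h j := by
  have e1 : (S.w * S.y 1 P.z1 : ℂ) = -(P.b 0 + s * P.d 0) := by exact_mod_cast hS.y_left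
  have e2 : (S.w * S.Y 1 P.z1 : ℂ) = -(P.a 0 + s * P.c 0) := by exact_mod_cast hS.Y_left
  have e3 : (S.w * S.y 0 P.z2 : ℂ) = P.b 1 + s * P.d 1 := by exact_mod_cast hS.y_right
  have e4 : (S.w * S.Y 0 P.z2 : ℂ) = P.a 1 + s * P.c 1 := by exact_mod_cast hS.Y_right
  have e5 : ((P.a 0 + s * P.c 0) * S.y 0 P.z1 - (P.b 0 + s * P.d 0) * S.Y 0 P.z1 : ℂ) = -1 := by
    exact_mod_cast hS.left
  have e6 : ((P.a 1 + s * P.c 1) * S.y 1 P.z2 - (P.b 1 + s * P.d 1) * S.Y 1 P.z2 : ℂ) = -1 := by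
    exact_mod_cast hS.right
  have m01 : (S.w * bdry S 0 1 : ℂ) = P.D 0 := by exact_mod_cast hS.w_mul_bdry_zero_one
  have m10 : (S.w * bdry S 1 0 : ℂ) = P.D 1 := by exact_mod_cast hS.w_mul_bdry_one_zero
  have hm : ∀ j k, (bdry S j k : ℂ) = P.c j * S.y k (P.zb j) - P.d j * S.Y k (P.zb j) :=
    fun j k => by simp [bdry]
  have hw : (S.w : ℂ) ≠ 0 := Complex.ofReal_ne_zero.2 hS.w_ne
  have hfj := hf _ (P.zb_mem j)
  have hFj := hF _ (P.zb_mem j)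
  have hIj := hI j
  have m0 := hm j 0
  have m1 := hm j 1
  fin_cases j
  · change f P.z1 = κ * (S.green _ P.z1 + (h 0 * S.y 0 P.z1 + h 1 * S.y 1 P.z1)) at hfj
    change F P.z1 = κ * (S.greenDeriv _ P.z1 + (h 0 * S.Y 0 P.z1 + h 1 * S.Y 1 P.z1)) at hFj
    change P.c 0 * f P.z1 - P.d 0 * F P.z1 = h 0 ∧ (P.a 0 + s * P.c 0) * f P.z1 -
      (P.b 0 + s * P.d 0) * F P.z1 = -κ * h 0
    change (bdry S 0 0 : ℂ) = P.c 0 * S.y 0 P.z1 - P.d 0 * S.Y 0 P.z1 at m0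
    change (bdry S 0 1 : ℂ) = P.c 0 * S.y 1 P.z1 - P.d 0 * S.Y 1 P.z1 at m1
    simp only [GreenData.green, GreenData.greenDeriv, intervalIntegral.integral_same, mul_zero,
      zero_add] at hfj hFj
    simp only [Fin.zero_eta] at hIj
    generalize (∫ t in P.z1..P.z2, (S.y 0 t : ℂ) * (P.r t * f t)) = I at *
    refine ⟨?_, ?_⟩
    · by_cases hD : P.D 0 = 0
      · obtain ⟨hc, hd⟩ := hcd 0 hD
        simp [hc, hd, hh 0 hD]
      · rw [← hIj hD, hfj, hFj]
        linear_combination -κ * h 0 * m0 - κ * h 1 * m1 + κ * I * m01 - κ * I * S.w * m1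
    · have k0 : ((P.a 0 + s * P.c 0) * S.y 1 P.z1 - (P.b 0 + s * P.d 0) * S.Y 1 P.z1 : ℂ) = 0 := by
        apply mul_left_cancel₀ hw
        linear_combination (P.a 0 + s * P.c 0) * e1 - (P.b 0 + s * P.d 0) * e2
      rw [hfj, hFj]
      linear_combination κ * (S.w * I + h 1) * k0 + κ * h 0 * e5
  · change f P.z2 = κ * (S.green _ P.z2 + (h 0 * S.y 0 P.z2 + h 1 * S.y 1 P.z2)) at hfj
    change F P.z2 = κ * (S.greenDeriv _ P.z2 + (h 0 * S.Y 0 P.z2 + h 1 * S.Y 1 P.z2)) at hFj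
    change P.c 1 * f P.z2 - P.d 1 * F P.z2 = h 1 ∧ (P.a 1 + s * P.c 1) * f P.z2 -
      (P.b 1 + s * P.d 1) * F P.z2 = -κ * h 1
    change (bdry S 1 0 : ℂ) = P.c 1 * S.y 0 P.z2 - P.d 1 * S.Y 0 P.z2 at m0
    change (bdry S 1 1 : ℂ) = P.c 1 * S.y 1 P.z2 - P.d 1 * S.Y 1 P.z2 at m1
    simp only [GreenData.green, GreenData.greenDeriv, intervalIntegral.integral_same, mul_zero,
      add_zero] at hfj hFj
    simp only [Fin.mk_one] at hIj
    generalize (∫ t in P.z1..P.z2, (S.y 1 t : ℂ) * (P.r t * f t)) = I at *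
    refine ⟨?_, ?_⟩
    · by_cases hD : P.D 1 = 0
      · obtain ⟨hc, hd⟩ := hcd 1 hD
        simp [hc, hd, hh 1 hD]
      · rw [← hIj hD, hfj, hFj]
        linear_combination -κ * h 0 * m0 - κ * h 1 * m1 + κ * I * m10 - κ * I * S.w * m0
    · have k0 : ((P.a 1 + s * P.c 1) * S.y 0 P.z2 - (P.b 1 + s * P.d 1) * S.Y 0 P.z2 : ℂ) = 0 := by
        apply mul_left_cancel₀ hw
        linear_combination (P.a 1 + s * P.c 1) * e3 - (P.b 1 + s * P.d 1) * e4
      rw [hfj, hFj]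
      linear_combination κ * (S.w * I + h 0) * k0 + κ * h 1 * e6

end SLP

/-- A sum over a subtype of `Fin 2` in terms of the extension by zero. -/
theorem sum_subtype_smul_eq {p : Fin 2 → Prop} [DecidablePred p] {M : Type*} [AddCommGroup M]
    [Module ℂ M] (h : Subtype p → ℂ) (f : Fin 2 → M) :
    ∑ j, h j • f j = Function.extend Subtype.val h 0 0 • f 0 +
      Function.extend Subtype.val h 0 1 • f 1 := by
  rw [← Fin.sum_univ_two fun j => Function.extend Subtype.val h 0 j • f j,
    ← Finset.sum_filter_add_sum_filter_not Finset.univ p]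
  have h2 : ∑ j with ¬ p j, Function.extend Subtype.val h 0 j • f j = 0 := by
    refine Finset.sum_eq_zero fun j hj => ?_
    rw [Function.extend_apply', Pi.zero_apply, zero_smul]
    rintro ⟨x, rfl⟩
    exact (Finset.mem_filter.1 hj).2 x.2
  rw [h2, add_zero, ← Finset.sum_subtype_eq_sum_filter, Finset.subtype_univ]
  exact Finset.sum_congr rfl fun j _ => by rw [Subtype.val_injective.extend_apply]

section WeightedMeasure

variable {a b : ℝ} {r : ℝ → ℝ}

theorem memLp_weightedMeasure (hr : Continuous r) {f : ℝ → ℂ} (hf : ContinuousOn f (Set.Icc a b)) :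
    MemLp (fun x : Set.Icc a b => f x) 2 (weightedMeasure a b r) := by
  have := isFiniteMeasure_weightedMeasure (a := a) (b := b) hr
  have hc : Continuous fun x : Set.Icc a b => f x := continuousOn_iff_continuous_domRestrict.1 hf
  obtain ⟨K, hK⟩ := isCompact_Icc.exists_bound_of_continuousOn hf
  exact MemLp.of_bound hc.aestronglyMeasurable K (Eventually.of_forall fun x => hK x x.2)

theorem inner_weightedMeasure (hr : Continuous r) (hpos : ∀ t ∈ Set.Icc a b, 0 < r t)
    (hab : a ≤ b) {u v : Lp ℂ 2 (weightedMeasure a b r)} {f g : ℝ → ℂ}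
    (hu : u =ᵐ[weightedMeasure a b r] fun x => f x)
    (hv : v =ᵐ[weightedMeasure a b r] fun x => g x) :
    inner ℂ u v = ∫ t in a..b, (r t : ℂ) * (starRingEnd ℂ (f t) * g t) := by
  rw [L2.inner_def, ← integral_weightedMeasure hr hpos hab]
  refine integral_congr_ae ?_
  filter_upwards [hu, hv] with x h1 h2
  rw [h1, h2, RCLike.inner_apply, mul_comm]

theorem ae_eq_iff_eqOn_weightedMeasure (hr : Continuous r) (hpos : ∀ t ∈ Set.Icc a b, 0 < r t)
    (hab : a < b) {f g : ℝ → ℂ} (hf : ContinuousOn f (Set.Icc a b))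
    (hg : ContinuousOn g (Set.Icc a b)) :
    ((fun x => f x) =ᵐ[weightedMeasure a b r] fun x => g x) ↔ Set.EqOn f g (Set.Icc a b) := by
  refine ⟨fun h => ?_, fun h => Eventually.of_forall fun x => h x.2⟩
  refine Measure.eqOn_Icc_of_ae_eq volume hab.ne ?_ hf hg
  exact (ae_restrict_iff' measurableSet_Icc).2
    ((ae_weightedMeasure_iff hr hpos (p := fun t => f t = g t)).1 h)

theorem GreenData.green_congr_ae {P Q : ℝ → ℝ} (S : GreenData a b P Q) {G G' : ℝ → ℂ}
    (h : ∀ᵐ t, t ∈ Set.Icc a b → G t = G' t) {x : ℝ} (hx : x ∈ Set.Icc a b) :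
    S.green G x = S.green G' x := by
  have hab := hx.1.trans hx.2
  have key : ∀ (j : Fin 2) (c d : ℝ), c ∈ Set.Icc a b → d ∈ Set.Icc a b →
      ∫ t in c..d, (S.y j t : ℂ) * G t = ∫ t in c..d, (S.y j t : ℂ) * G' t :=
    fun j c d hc hd => intervalIntegral.integral_congr_ae (h.mono fun t ht hcd => by
      rw [ht (Set.uIcc_subset_Icc hc hd (Set.uIoc_subset_uIcc hcd))])
  rw [green, green, key 1 a x (Set.left_mem_Icc.2 hab) hx, key 0 x b hx (Set.right_mem_Icc.2 hab)]

end WeightedMeasure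

namespace SLP

variable (P : SLP)

/-- The indefinite inner product in terms of the boundary functionals. -/
noncomputable def form (φ ψ : ℝ → ℂ) : ℂ :=
  (∫ z in P.z1..P.z2, (P.r z : ℂ) * (starRingEnd ℂ (φ z) * ψ z)) +
    ∑ j, (P.D j : ℂ)⁻¹ * (starRingEnd ℂ (P.Cop j φ) * P.Cop j ψ)

theorem tendsto_integral_normSq_null_series
    (hcd : ∀ j, P.D j = 0 → P.c j = 0 ∧ P.d j = 0) {lam : ℕ → ℝ} {φ : ℕ → ℝ → ℂ}
    (hmono : StrictMono lam) (heig : ∀ n, P.IsEigenpair (lam n) (φ n))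
    (hall : ∀ μ : ℂ, P.IsEigenvalue μ → ∃ n, μ = lam n)
    {ε : ℕ → ℝ} (hε1 : ∀ n, ε n = 1 ∨ ε n = -1)
    (horth : ∀ m n, m ≠ n → P.form (φ m) (φ n) = 0) (hε : ∀ n, P.form (φ n) (φ n) = ε n)
    {i : Fin 2} (hi : P.D i ≠ 0) :
    Tendsto (fun N : ℕ => ∫ z in P.z1..P.z2, Complex.normSq (∑ n ∈ Finset.range N,
      ((ε n : ℂ) * ((P.D i : ℂ)⁻¹ * starRingEnd ℂ (P.Cop i (φ n)))) * φ n z) * P.r z)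
      atTop (𝓝 0) := by
  have hr := P.hr.continuous
  have hpos := P.hrpos
  have hab := P.hz
  have hle := P.hz.le
  set s : ℝ := lam 0 - 1 with hs_def
  have hls : ∀ n, lam n - s ≠ 0 := fun n => by
    have := hmono.monotone (Nat.zero_le n)
    rw [hs_def]
    linarith
  have hs : ¬ P.IsEigenvalue s := fun h => by
    obtain ⟨n, hn⟩ := hall s h
    exact hls n (sub_eq_zero.2 (Complex.ofReal_injective hn).symm)
  obtain ⟨S, hS⟩ := P.exists_isAdapted hcd hs
  let X := weightedMeasure P.z1 P.z2 P.r
  obtain ⟨T, hTc, hTs, hT⟩ : ∃ T : Lp ℂ 2 X →L[ℂ] Lp ℂ 2 X, IsCompactOperator T ∧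
      (T : Lp ℂ 2 X →ₗ[ℂ] Lp ℂ 2 X).IsSymmetric ∧ ∀ g : Lp ℂ 2 X,
        T g =ᵐ[X] fun x => S.green (fun t => (P.r t : ℂ) * Set.IccExtend hle g t) x :=
    S.exists_isCompactOperator_green P.hz hr hpos
  have : IsFiniteMeasure X := isFiniteMeasure_weightedMeasure hr
  have hTf : ∀ (g : Lp ℂ 2 X) (f : ℝ → ℂ), g =ᵐ[X] (fun x => f x) →
      T g =ᵐ[X] fun x => S.green (fun t => P.r t * f t) x := fun g f hgf => by
    have h1 : ∀ᵐ t, t ∈ Set.Icc P.z1 P.z2 → Set.IccExtend hle g t = f t := by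
      refine (ae_weightedMeasure_iff hr hpos).1 (hgf.mono fun x hx => ?_)
      rw [Set.IccExtend_val, hx]
    filter_upwards [hT g] with x hx
    rw [hx]
    exact S.green_congr_ae (h1.mono fun t ht htI => by rw [ht htI]) x.2
  have hφc : ∀ n, ContinuousOn (φ n) (Set.Icc P.z1 P.z2) := fun n =>
    (heig n).1.continuous.continuousOn
  let ξ : Fin 2 → Lp ℂ 2 X := fun j => (memLp_weightedMeasure hr (S.continuousOn_y j)).toLp
  have hξ : ∀ j, ξ j =ᵐ[X] fun x => (S.y j x : ℂ) := fun j => MemLp.coeFn_toLp _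
  let φ' : ℕ → Lp ℂ 2 X := fun n => (memLp_weightedMeasure hr (hφc n)).toLp
  have hφ' : ∀ n, φ' n =ᵐ[X] fun x => φ n x := fun n => MemLp.coeFn_toLp _
  have hξi : ∀ (j : Fin 2) (g : Lp ℂ 2 X) (f : ℝ → ℂ), g =ᵐ[X] (fun x => f x) →
      inner ℂ (ξ j) g = ∫ t in P.z1..P.z2, (S.y j t : ℂ) * (P.r t * f t) := fun j g f hgf => by
    rw [inner_weightedMeasure hr hpos hle (f := fun t => (S.y j t : ℂ)) (hξ j) hgf]
    simp only [Complex.conj_ofReal, mul_left_comm]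
  let ι := {j : Fin 2 // P.D j ≠ 0}
  let ex : (ι → ℂ) → Fin 2 → ℂ := fun h => Function.extend Subtype.val h 0
  have hex : ∀ (h : ι → ℂ) (j : ι), ex h j = h j := fun h j => Subtype.val_injective.extend_apply ..
  have hex0 : ∀ (h : ι → ℂ) (j : Fin 2), P.D j = 0 → ex h j = 0 := fun h j hj => by
    refine Function.extend_apply' _ _ _ ?_
    rintro ⟨x, rfl⟩
    exact x.2 hj
  have hsum : ∀ {M : Type} [AddCommGroup M] [Module ℂ M] (h : ι → ℂ) (f : Fin 2 → M),
      ∑ j : ι, h j • f j = ex h 0 • f 0 + ex h 1 • f 1 := fun h f => sum_subtype_smul_eq h f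
  let η : ℕ → ι → ℂ := fun n j => P.Cop j (φ n)
  have hexη : ∀ n j, ex (η n) j = P.Cop j (φ n) := fun n j => by
    by_cases hj : P.D j = 0
    · rw [hex0 _ _ hj, P.Cop_eq, (hcd j hj).1, (hcd j hj).2]
      simp
    · exact hex (η n) ⟨j, hj⟩
  have hTsum : ∀ (g : Lp ℂ 2 X) (f : ℝ → ℂ) (h : ι → ℂ), g =ᵐ[X] (fun x => f x) →
      (T g + ∑ j, h j • ξ j : Lp ℂ 2 X) =ᵐ[X] fun x => S.green (fun t => P.r t * f t) x +
        (ex h 0 * S.y 0 x + ex h 1 * S.y 1 x) := fun g f h hgf => by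
    rw [hsum h ξ]
    filter_upwards [hTf g f hgf, hξ 0, hξ 1, Lp.coeFn_add (T g) (ex h 0 • ξ 0 + ex h 1 • ξ 1),
      Lp.coeFn_add (ex h 0 • ξ 0) (ex h 1 • ξ 1), Lp.coeFn_smul (ex h 0) (ξ 0),
      Lp.coeFn_smul (ex h 1) (ξ 1)] with x h1 h2 h3 h4 h5 h6 h7
    rw [h4, Pi.add_apply, h1, h5, Pi.add_apply, h6, h7, Pi.smul_apply, Pi.smul_apply, h2, h3,
      smul_eq_mul, smul_eq_mul]
  have hgint : ∀ g : Lp ℂ 2 X,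
      IntervalIntegrable (fun t => (P.r t : ℂ) * Set.IccExtend hle g t) volume P.z1 P.z2 := by
    intro g
    refine intervalIntegrable_of_integrable_weightedMeasure hr hpos hle ?_
    simp only [Set.IccExtend_val]
    exact (Lp.memLp g).integrable one_le_two
  have hext : ∀ g : Lp ℂ 2 X, g =ᵐ[X] fun x => Set.IccExtend hle g x := fun g =>
    Eventually.of_forall fun x => (Set.IccExtend_val hle _ x).symm
  have hcy : ∀ k l : ℂ, ContinuousOn (fun x => k * S.y 0 x + l * S.y 1 x) (Set.Icc P.z1 P.z2) :=
    fun k l => (continuousOn_const.mul (S.continuousOn_y 0)).add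
      (continuousOn_const.mul (S.continuousOn_y 1))
  have hcg : ∀ (g : Lp ℂ 2 X) (h : ι → ℂ), ContinuousOn (fun x => S.green (fun t => P.r t *
      Set.IccExtend hle g t) x + (ex h 0 * S.y 0 x + ex h 1 * S.y 1 x)) (Set.Icc P.z1 P.z2) :=
    fun g h => (S.continuousOn_green hle (hgint g)).add (hcy _ _)
  have hinj' : ∀ (g : Lp ℂ 2 X) (h : ι → ℂ), T g + ∑ j, h j • ξ j = 0 → g = 0 ∧ h = 0 := by
    intro g h h0
    have h1 := hTsum g _ h (hext g)
    rw [h0] at h1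
    have h2 := (ae_eq_iff_eqOn_weightedMeasure hr hpos hab (hcg g h) continuousOn_const).1
      (h1.symm.trans (Lp.coeFn_zero ℂ 2 X))
    obtain ⟨h3, h4⟩ := S.eq_zero_of_green_add_eq_zero hab (fun t ht => P.pinv_ne_zero ht)
      (hgint g) h2
    refine ⟨?_, funext fun j => by rw [← hex h j, h4]; rfl⟩
    rw [Lp.eq_zero_iff_ae_eq_zero]
    refine (hext g).trans ((ae_weightedMeasure_iff hr hpos
      (p := fun t => Set.IccExtend hle g t = 0)).2 (h3.mono fun t ht htI => ?_))
    exact (mul_eq_zero.1 (ht htI)).resolve_left (Complex.ofReal_ne_zero.2 (hpos t htI).ne')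
  have hform : ∀ m n, inner ℂ (φ' m) (φ' n) + ∑ j : ι, (P.D j : ℂ)⁻¹ *
      (starRingEnd ℂ (η m j) * η n j) = P.form (φ m) (φ n) := fun m n => by
    rw [inner_weightedMeasure hr hpos hle (hφ' m) (hφ' n), form]
    congr 1
    have := hsum (η n) fun j => (P.D j : ℂ)⁻¹ * starRingEnd ℂ (P.Cop j (φ m))
    rw [hexη, hexη] at this
    simp only [smul_eq_mul] at this
    simp only [Fin.sum_univ_two, ← mul_assoc, mul_comm _ (P.Cop _ (φ n)), mul_comm _ (η n _)]
    simpa only [mul_assoc] using this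
  have hsys := fun n t ht => (heig n).hasDerivAt (t := t) ht
  have hdirect : ∀ n j, P.c j * φ n (P.zb j) - P.d j * P.quasiDeriv (φ n) (P.zb j) =
      P.Cop j (φ n) := fun n j => rfl
  have hF : ∀ n, ∀ t ∈ Set.Icc P.z1 P.z2, HasDerivAt (P.quasiDeriv (φ n))
      ((P.q t - s * P.r t : ℝ) * φ n t - (lam n - s : ℂ) * (P.r t * φ n t)) t := fun n t ht =>
    (hsys n t ht).2.congr_deriv (by push_cast; ring)
  have hbc : ∀ n j, (P.a j + s * P.c j) * φ n (P.zb j) -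
      (P.b j + s * P.d j) * P.quasiDeriv (φ n) (P.zb j) = -(lam n - s : ℂ) * P.Cop j (φ n) :=
    fun n j => by
      have := (heig n).2.2.2 j
      rw [P.Bop_eq, P.Cop_eq] at this
      rw [P.Cop_eq]
      linear_combination -this
  have hκ : ∀ n, (lam n - s : ℂ) ≠ 0 := fun n => by exact_mod_cast hls n
  have hφeq : ∀ n, T (φ' n) + ∑ j, η n j • ξ j = (lam n - s : ℂ)⁻¹ • φ' n := fun n => by
    rw [Lp.ext_iff]
    filter_upwards [hTsum _ _ (η n) (hφ' n), hφ' n, Lp.coeFn_smul (lam n - s : ℂ)⁻¹ (φ' n)]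
      with x h1 h2 h3
    rw [h1, h3, Pi.smul_apply, h2, smul_eq_mul, hexη, hexη, eq_inv_mul_iff_mul_eq₀ (hκ n)]
    exact hS.mul_green_eq (fun t ht => (hsys n t ht).1) (hF n) (hbc n) x.2
  have hsumM : ∀ (h : ι → ℂ) (j : Fin 2), ∑ k : ι, (bdry S j k : ℂ) * h k =
      bdry S j 0 * ex h 0 + bdry S j 1 * ex h 1 := fun h j => by
    have := hsum h fun k => (bdry S j k : ℂ)
    simp only [smul_eq_mul] at this
    simp only [mul_comm (bdry S j _ : ℂ)]
    exact this
  have hηeq : ∀ n (j : ι), P.D j * inner ℂ (ξ j) (φ' n) + ∑ k : ι, (bdry S j k : ℂ) * η n k =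
      (lam n - s : ℂ)⁻¹ * η n j := fun n j => by
    rw [hξi _ _ _ (hφ' n), hsumM, hexη, hexη, eq_inv_mul_iff_mul_eq₀ (hκ n)]
    exact hS.mul_integral_eq (fun t ht => (hsys n t ht).1) (hF n) (hdirect n) (hbc n) j
  have hall' : ∀ (μ : ℂ) (g : Lp ℂ 2 X) (h : ι → ℂ), ¬ (g = 0 ∧ h = 0) →
      T g + ∑ j, h j • ξ j = μ • g →
      (∀ j : ι, P.D j * inner ℂ (ξ j) g + ∑ k : ι, (bdry S j k : ℂ) * h k = μ * h j) →
      ∃ n, inner ℂ (φ' n) g + ∑ j : ι, (P.D j : ℂ)⁻¹ * (starRingEnd ℂ (η n j) * h j) ≠ 0 := by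
    intro μ g h hne h1 h2
    have hμ : μ ≠ 0 := fun hμ => hne (hinj' g h (by rw [h1, hμ, zero_smul]))
    let f : ℝ → ℂ := fun x => μ⁻¹ * (S.green (fun t => P.r t * Set.IccExtend hle g t) x +
      (ex h 0 * S.y 0 x + ex h 1 * S.y 1 x))
    have hfc : ContinuousOn f (Set.Icc P.z1 P.z2) := continuousOn_const.mul (hcg g h)
    have hgf : g =ᵐ[X] fun x => f x := by
      have h3 := hTsum g _ h (hext g)
      rw [h1] at h3
      filter_upwards [h3, Lp.coeFn_smul μ g] with x h4 h5
      rw [h5, Pi.smul_apply, smul_eq_mul] at h4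
      simp only [f]
      rw [← h4, inv_mul_cancel_left₀ hμ]
    have hgf' : ∀ᵐ t, t ∈ Set.Icc P.z1 P.z2 → Set.IccExtend hle g t = f t := by
      refine (ae_weightedMeasure_iff hr hpos).1 (hgf.mono fun x hx => ?_)
      rw [Set.IccExtend_val, hx]
    have hf : ∀ t ∈ Set.Icc P.z1 P.z2, f t = μ⁻¹ * (S.green (fun t => P.r t * f t) t +
        (ex h 0 * S.y 0 t + ex h 1 * S.y 1 t)) := fun t ht => by
      have e : S.green (fun t => P.r t * Set.IccExtend hle g t) t =
          S.green (fun t => P.r t * f t) t :=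
        S.green_congr_ae (hgf'.mono fun t ht htI => by rw [ht htI]) ht
      rw [← e]
    let F : ℝ → ℂ := fun t => μ⁻¹ * (S.greenDeriv (fun t => P.r t * f t) t +
        (ex h 0 * S.Y 0 t + ex h 1 * S.Y 1 t))
    have hG : ContinuousOn (fun t => P.r t * f t) (Set.Icc P.z1 P.z2) :=
      (Complex.continuous_ofReal.comp hr).continuousOn.mul hfc
    have hb := hS.boundary_of_green (F := F) hcd hf (fun t _ => rfl) (hex0 h) fun j hj => by
      have := h2 ⟨j, hj⟩
      rw [hξi _ _ _ hgf, hsumM, ← hex h] at this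
      rw [inv_mul_eq_iff_eq_mul₀ hμ]
      exact this
    obtain ⟨ψ, hψ, hψf⟩ := P.exists_isEigenpair (lam := s + μ⁻¹) (f := f) (F := F)
      (fun t ht => by
        have e := ((S.hasDerivWithinAt_green hG ht).add
          (((S.hasDerivAt_y 0 t ht).ofReal_comp.const_mul (ex h 0)).add
          ((S.hasDerivAt_y 1 t ht).ofReal_comp.const_mul (ex h 1))).hasDerivWithinAt).const_mul μ⁻¹
        refine (e.congr hf (hf t ht)).congr_deriv ?_
        simp only [F]
        push_cast
        ring)
      (fun t ht => by
        have e := ((S.hasDerivWithinAt_greenDeriv hG ht).add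
          (((S.hasDerivAt_Y 0 t ht).ofReal_comp.const_mul (ex h 0)).add
          ((S.hasDerivAt_Y 1 t ht).ofReal_comp.const_mul (ex h 1))).hasDerivWithinAt).const_mul μ⁻¹
        refine e.congr_deriv ?_
        push_cast
        linear_combination -(P.q t - s * P.r t : ℂ) * hf t ht)
      (by
        by_contra! h0
        have hg0 : g = 0 := by
          rw [Lp.eq_zero_iff_ae_eq_zero]
          exact hgf.trans (Eventually.of_forall fun x => h0 x x.2)
        exact hne (hinj' g h (by rw [h1, hg0, smul_zero])))
      (fun j => by linear_combination -(hb j).2 - μ⁻¹ * (hb j).1)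
    obtain ⟨n, hn⟩ := hall _ ⟨ψ, hψ⟩
    rw [hn] at hψ
    obtain ⟨k, hk⟩ := (heig n).exists_eq_mul hψ (P.shifted_ne_zero hcd (lam n) i)
    have hg : g = k • φ' n := by
      rw [Lp.ext_iff]
      filter_upwards [hgf, hφ' n, Lp.coeFn_smul k (φ' n)] with x h3 h4 h5
      rw [h3, h5, Pi.smul_apply, h4, ← (hψf x x.2).1, (hk x x.2).1, smul_eq_mul]
    have hh : h = k • η n := funext fun j => by
      rw [← hex h j, ← (hb j).1, ← (hψf _ (P.zb_mem j)).1, ← (hψf _ (P.zb_mem j)).2,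
        (hk _ (P.zb_mem j)).1, (hk _ (P.zb_mem j)).2, Pi.smul_apply, smul_eq_mul]
      simp only [η, P.Cop_eq]
      ring
    refine ⟨n, ?_⟩
    have hval : inner ℂ (φ' n) g + ∑ j : ι, (P.D j : ℂ)⁻¹ * (starRingEnd ℂ (η n j) * h j) =
        k * ε n := by
      rw [← hε, ← hform, hg, inner_smul_right, mul_add, Finset.mul_sum, hh]
      congr 1
      exact Finset.sum_congr rfl fun j _ => by rw [Pi.smul_apply, smul_eq_mul]; ring
    rw [hval]
    refine mul_ne_zero (fun hk0 => hne ⟨by rw [hg, hk0, zero_smul], by rw [hh, hk0, zero_smul]⟩) ?_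
    rcases hε1 n with h | h <;> simp [h]
  have key := tendsto_sum_of_compact_block hTc hTs (fun j : ι => ξ j) (D := fun j => P.D j)
    (fun j => j.2) (M := fun j k => bdry S j k) (fun j k => hS.inv_D_mul_bdry j.2 k.2) hinj' hφeq
    hηeq hε1 (fun m n hmn => (hform m n).trans (horth m n hmn))
    (fun n => (hform n n).trans (hε n)) hall' 0 (Pi.single ⟨i, hi⟩ 1)
  have hcoef : ∀ n, inner ℂ (φ' n) 0 + ∑ j : ι, (P.D j : ℂ)⁻¹ * (starRingEnd ℂ (η n j) *
      (Pi.single ⟨i, hi⟩ 1 : ι → ℂ) j) = (P.D i : ℂ)⁻¹ * starRingEnd ℂ (P.Cop i (φ n)) := by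
    intro n
    rw [inner_zero_right, zero_add, Finset.sum_eq_single ⟨i, hi⟩]
    · rw [Pi.single_eq_same, mul_one]
    · intro j _ hj
      rw [Pi.single_eq_of_ne hj, mul_zero, mul_zero]
    · simp
  simp only [hcoef] at key
  have hnorm := (key.norm.pow 2)
  rw [norm_zero, zero_pow two_ne_zero] at hnorm
  refine hnorm.congr fun N => ?_
  set c : ℕ → ℂ := fun n => (ε n : ℂ) * ((P.D i : ℂ)⁻¹ * starRingEnd ℂ (P.Cop i (φ n)))
  have hsumae : (∑ n ∈ Finset.range N, c n • φ' n : Lp ℂ 2 X) =ᵐ[X]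
      fun x => ∑ n ∈ Finset.range N, c n * φ n x := by
    induction N with
    | zero => exact Lp.coeFn_zero ℂ 2 X
    | succ N ih =>
      rw [Finset.sum_range_succ]
      filter_upwards [ih, Lp.coeFn_add (∑ n ∈ Finset.range N, c n • φ' n) (c N • φ' N),
        Lp.coeFn_smul (c N) (φ' N), hφ' N] with x h1 h2 h3 h4
      rw [h2, Pi.add_apply, h1, h3, Pi.smul_apply, h4, smul_eq_mul, Finset.sum_range_succ]
  have h1 := inner_weightedMeasure hr hpos hle
    (f := fun t => ∑ n ∈ Finset.range N, c n * φ n t)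
    (g := fun t => ∑ n ∈ Finset.range N, c n * φ n t) hsumae hsumae
  rw [inner_self_eq_norm_sq_to_K] at h1
  apply Complex.ofReal_injective
  rw [← intervalIntegral.integral_ofReal]
  rw [Complex.ofReal_pow]
  refine h1.trans (intervalIntegral.integral_congr fun t _ => ?_)
  simp only [Complex.ofReal_mul, Complex.normSq_eq_conj_mul_self]
  exact mul_comm _ _

end SLP

namespace SLP

/-- Lagrange's identity for two eigen-solutions. -/
theorem IsEigenpair.lagrange {P : SLP} {lam μ : ℂ} {φ ψ : ℝ → ℂ} (hφ : P.IsEigenpair lam φ)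
    (hψ : P.IsEigenpair μ ψ) :
    (lam - μ) * (∫ t in P.z1..P.z2, (P.r t : ℂ) * (φ t * ψ t)) =
      (φ P.z2 * P.quasiDeriv ψ P.z2 - P.quasiDeriv φ P.z2 * ψ P.z2) -
      (φ P.z1 * P.quasiDeriv ψ P.z1 - P.quasiDeriv φ P.z1 * ψ P.z1) := by
  rw [← intervalIntegral.integral_const_mul]
  refine intervalIntegral.integral_eq_sub_of_hasDerivAt
    (f := fun t => φ t * P.quasiDeriv ψ t - P.quasiDeriv φ t * ψ t) (fun t ht => ?_) ?_
  · rw [Set.uIcc_of_le P.hz.le] at ht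
    obtain ⟨h1, h2⟩ := hφ.hasDerivAt ht
    obtain ⟨h3, h4⟩ := hψ.hasDerivAt ht
    exact ((h1.mul h4).sub (h2.mul h3)).congr_deriv (by ring)
  · have := P.hr.continuous
    have := hφ.1.continuous
    have := hψ.1.continuous
    exact Continuous.intervalIntegrable (by fun_prop) _ _

/-- At an active boundary, the Wronskian of two eigen-solutions is determined by the boundary
functionals. -/
theorem IsEigenpair.wronskian_boundary {P : SLP} {lam μ : ℂ} {φ ψ : ℝ → ℂ}
    (hφ : P.IsEigenpair lam φ) (hψ : P.IsEigenpair μ ψ) (j : Fin 2) :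
    (P.a j * P.d j - P.b j * P.c j : ℂ) *
      (φ (P.zb j) * P.quasiDeriv ψ (P.zb j) - P.quasiDeriv φ (P.zb j) * ψ (P.zb j)) =
      (lam - μ) * (P.Cop j φ * P.Cop j ψ) := by
  have h1 := hφ.2.2.2 j
  have h2 := hψ.2.2.2 j
  have e : (lam - μ) * (P.Cop j φ * P.Cop j ψ) = P.Cop j φ * P.Bop j ψ - P.Bop j φ * P.Cop j ψ := by
    linear_combination P.Cop j φ * h2 - P.Cop j ψ * h1
  rw [e]
  simp only [Bop_eq, Cop_eq]
  ring

variable (P : SLP)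

theorem conj_Cop {φ : ℝ → ℂ} (h : ∀ z, (φ z).im = 0) (j : Fin 2) :
    starRingEnd ℂ (P.Cop j φ) = P.Cop j φ := by
  have h1 : (fun z => star (φ z)) = φ := funext fun z => Complex.conj_eq_iff_im.2 (h z)
  have h2 : starRingEnd ℂ (deriv φ (P.zb j)) = deriv φ (P.zb j) := by
    conv_rhs => rw [← h1]
    exact deriv.star.symm
  simp [Cop, h2, Complex.conj_eq_iff_im.2 (h _)]

/-- The problem in which the boundary conditions with `D j = 0` are made independent of the
spectral parameter. -/
noncomputable def reduce : SLP :=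
  { P with
    c := fun j => if P.D j = 0 then 0 else P.c j
    d := fun j => if P.D j = 0 then 0 else P.d j }

theorem D_reduce (j : Fin 2) : P.reduce.D j = P.D j := by
  have hc : P.reduce.c j = if P.D j = 0 then 0 else P.c j := rfl
  have hd : P.reduce.d j = if P.D j = 0 then 0 else P.d j := rfl
  rw [show P.reduce.D j = P.sgn j * (P.a j * P.reduce.d j - P.b j * P.reduce.c j) from rfl, hc, hd]
  by_cases h : P.D j = 0
  · rw [if_pos h, if_pos h, h]
    simp
  · rw [if_neg h, if_neg h]
    rfl

theorem Cop_reduce {j : Fin 2} (h : P.D j ≠ 0) (φ : ℝ → ℂ) : P.reduce.Cop j φ = P.Cop j φ := by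
  simp [Cop, reduce, if_neg h, zb]

theorem Cop_reduce_of_eq_zero {j : Fin 2} (h : P.D j = 0) (φ : ℝ → ℂ) :
    P.reduce.Cop j φ = 0 := by
  simp [Cop, reduce, if_pos h]

theorem exists_Cop_eq_mul_Bop {j : Fin 2} (h : P.D j = 0) :
    ∃ k : ℝ, ∀ φ, P.Cop j φ = k * P.Bop j φ := by
  have h0 : P.a j * P.d j - P.b j * P.c j = 0 := by
    rw [D] at h
    exact (mul_eq_zero.1 h).resolve_left (by simp [sgn])
  obtain ⟨k, hc, hd⟩ : ∃ k : ℝ, P.c j = k * P.a j ∧ P.d j = k * P.b j := by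
    by_cases ha : P.a j = 0
    · have hb : P.b j ≠ 0 := fun hb => P.hab j (by rw [ha, hb])
      refine ⟨P.d j / P.b j, ?_, by field_simp⟩
      field_simp
      linear_combination -h0
    · refine ⟨P.c j / P.a j, by field_simp, ?_⟩
      field_simp
      linear_combination h0
  refine ⟨k, fun φ => ?_⟩
  rw [Cop_eq, Bop_eq, hc, hd]
  push_cast
  ring

variable {P} in
theorem IsEigenpair.of_reduce {lam : ℂ} {φ : ℝ → ℂ} (h : P.reduce.IsEigenpair lam φ) :
    P.IsEigenpair lam φ := by
  refine ⟨h.1, h.2.1, h.2.2.1, fun j => ?_⟩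
  have hj : -P.Bop j φ = lam * P.reduce.Cop j φ := h.2.2.2 j
  by_cases hD : P.D j = 0
  · obtain ⟨k, hk⟩ := P.exists_Cop_eq_mul_Bop hD
    rw [P.Cop_reduce_of_eq_zero hD, mul_zero, neg_eq_zero] at hj
    rw [hk, hj]
    ring
  · rw [hj, P.Cop_reduce hD]

variable {P} in
theorem IsEigenpair.reduce {lam : ℂ} {φ : ℝ → ℂ} (h : P.IsEigenpair lam φ)
    (hB : ∀ j, P.D j = 0 → P.Bop j φ = 0) : P.reduce.IsEigenpair lam φ := by
  refine ⟨h.1, h.2.1, h.2.2.1, fun j => ?_⟩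
  change -P.Bop j φ = lam * P.reduce.Cop j φ
  by_cases hD : P.D j = 0
  · rw [P.Cop_reduce_of_eq_zero hD, hB j hD]
    ring
  · rw [P.Cop_reduce hD]
    exact h.2.2.2 j

theorem assoc_zb {j : Fin 2} (h : P.inS j) (φ : ℝ → ℂ) : P.assoc φ (P.zb j) = P.Cop j φ := by
  have h10 : P.zb 1 ≠ P.zb 0 := P.hz.ne'
  fin_cases j
  · exact if_pos ⟨h, rfl⟩
  · exact (if_neg fun h' => h10 h'.2).trans (if_pos ⟨h, rfl⟩)

theorem assoc_of_mem_Ioo {t : ℝ} (ht : t ∈ Set.Ioo P.z1 P.z2) (φ : ℝ → ℂ) :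
    P.assoc φ t = φ t :=
  (if_neg fun h' => ht.1.ne' h'.2).trans (if_neg fun h' => ht.2.ne h'.2)

theorem D_eq_zero_of_not_inS {j : Fin 2} (h : ¬ P.inS j) : P.D j = 0 := by
  simp only [inS, ne_eq, not_not, Prod.mk.injEq] at h
  simp [D, h.1, h.2]

theorem inp_assoc (φ ψ : ℝ → ℂ) : P.inp (P.assoc φ) (P.assoc ψ) =
    (∫ z in P.z1..P.z2, (P.r z : ℂ) * (starRingEnd ℂ (φ z) * ψ z)) +
      ∑ j, (P.D j : ℂ)⁻¹ * (starRingEnd ℂ (P.Cop j φ) * P.Cop j ψ) := by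
  rw [inp]
  congr 1
  · rw [intervalIntegral.integral_of_le P.hz.le, intervalIntegral.integral_of_le P.hz.le,
      integral_Ioc_eq_integral_Ioo, integral_Ioc_eq_integral_Ioo]
    refine setIntegral_congr_fun measurableSet_Ioo fun t ht => ?_
    simp only [P.assoc_of_mem_Ioo ht]
    ring
  · rw [Sfin, Finset.sum_filter]
    refine Finset.sum_congr rfl fun j _ => ?_
    split_ifs with h
    · rw [P.assoc_zb h, P.assoc_zb h, mul_assoc]
    · simp [P.D_eq_zero_of_not_inS h]

theorem form_reduce (φ ψ : ℝ → ℂ) :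
    P.reduce.form φ ψ = P.inp (P.assoc φ) (P.assoc ψ) := by
  rw [inp_assoc, form]
  refine congrArg₂ (· + ·) rfl (Finset.sum_congr rfl fun j _ => ?_)
  rw [D_reduce]
  by_cases h : P.D j = 0
  · simp [h]
  · rw [P.Cop_reduce h, P.Cop_reduce h]

variable {P} in
/-- An eigen-solution orthogonal to one with a different eigenvalue satisfies the homogeneous
boundary condition at a boundary where the coefficients are degenerate. -/
theorem IsEigenpair.Bop_eq_zero {lam μ : ℝ} {φ ψ : ℝ → ℂ} (hψ : P.IsEigenpair μ ψ)
    (hφ : P.IsEigenpair lam φ) (hne : lam ≠ μ) (hreal : ∀ z, (φ z).im = 0)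
    (horth : P.inp (P.assoc φ) (P.assoc ψ) = 0) {i : Fin 2} (hi : P.D i ≠ 0) {j : Fin 2}
    (hj : P.D j = 0) : P.Bop j ψ = 0 := by
  obtain ⟨k, hk⟩ := P.exists_Cop_eq_mul_Bop hj
  have h1 := hψ.2.2.2 j
  rw [hk] at h1
  by_cases hk1 : 1 + μ * k = 0
  · have hk2 : 1 + lam * k ≠ 0 := fun h => by
      have : k = 0 := (mul_eq_zero.1 (show (lam - μ) * k = 0 by
        linear_combination h - hk1)).resolve_left (sub_ne_zero.2 hne)
      simp [this] at h
    have h2 := hφ.2.2.2 j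
    rw [hk] at h2
    have hBφ : P.Bop j φ = 0 := by
      refine (mul_eq_zero.1 ?_).resolve_left (Complex.ofReal_ne_zero.2 hk2)
      push_cast
      linear_combination -h2
    have hL := hφ.lagrange hψ
    have hWi := hφ.wronskian_boundary hψ i
    rw [inp_assoc, Fin.sum_univ_two, P.conj_Cop hreal, P.conj_Cop hreal] at horth
    simp only [Complex.conj_eq_iff_im.2 (hreal _)] at horth
    have hDi : (P.D i : ℂ) ≠ 0 := Complex.ofReal_ne_zero.2 hi
    have hW : φ (P.zb j) * P.quasiDeriv ψ (P.zb j) - P.quasiDeriv φ (P.zb j) * ψ (P.zb j) = 0 := by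
      have d0 : (P.D 0 : ℂ) = P.a 0 * P.d 0 - P.b 0 * P.c 0 := by exact_mod_cast P.D_zero
      have d1 : (P.D 1 : ℂ) = -(P.a 1 * P.d 1 - P.b 1 * P.c 1) := by exact_mod_cast P.D_one
      fin_cases i <;> fin_cases j
      · exact absurd hj hi
      · simp only [Fin.zero_eta, Fin.mk_one] at *
        rw [hj, Complex.ofReal_zero, inv_zero, zero_mul, add_zero] at horth
        change _ * (φ P.z1 * P.quasiDeriv ψ P.z1 - P.quasiDeriv φ P.z1 * ψ P.z1) = _ at hWi
        change φ P.z2 * P.quasiDeriv ψ P.z2 - P.quasiDeriv φ P.z2 * ψ P.z2 = 0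
        rw [← d0] at hWi
        apply mul_left_cancel₀ hDi
        linear_combination hWi - P.D 0 * hL + (lam - μ) * P.D 0 * horth
          - (lam - μ) * P.Cop 0 φ * P.Cop 0 ψ * mul_inv_cancel₀ hDi
      · simp only [Fin.zero_eta, Fin.mk_one] at *
        rw [hj, Complex.ofReal_zero, inv_zero, zero_mul, zero_add] at horth
        change _ * (φ P.z2 * P.quasiDeriv ψ P.z2 - P.quasiDeriv φ P.z2 * ψ P.z2) = _ at hWi
        change φ P.z1 * P.quasiDeriv ψ P.z1 - P.quasiDeriv φ P.z1 * ψ P.z1 = 0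
        rw [show (P.a 1 * P.d 1 - P.b 1 * P.c 1 : ℂ) = -P.D 1 by rw [d1]; ring] at hWi
        apply mul_left_cancel₀ hDi
        linear_combination -hWi + P.D 1 * hL - (lam - μ) * P.D 1 * horth
          + (lam - μ) * P.Cop 1 φ * P.Cop 1 ψ * mul_inv_cancel₀ hDi
      · exact absurd hj hi
    have hz := hφ.not_eq_zero_and_eq_zero (P.zb_mem j)
    rw [Bop_eq] at hBφ ⊢
    by_cases h0 : φ (P.zb j) = 0
    · refine (mul_eq_zero.1 ?_).resolve_left fun h => hz ⟨h0, h⟩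
      linear_combination P.quasiDeriv ψ (P.zb j) * hBφ - P.a j * hW
    · refine (mul_eq_zero.1 ?_).resolve_left h0
      linear_combination ψ (P.zb j) * hBφ - P.b j * hW
  · refine (mul_eq_zero.1 ?_).resolve_left (Complex.ofReal_ne_zero.2 hk1)
    push_cast
    linear_combination -h1

end SLP

/-- **null series.** For each `i ∈ S`, the partial sums
`s_N(z) = D_i⁻¹ Σ_{n<N} (Φ_n(z_i)/⟨Φ_n,Φ_n⟩) φ_n(z)` satisfy
`∫ |s_N|² r dz → 0` as `N → ∞`. -/
theorem statement_7 (P : SLP)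
    (hdef : P.RightDefinite ∨ (P.LeftDefinite ∧ ¬ P.IsEigenvalue 0))
    (lam : ℕ → ℝ) (φ : ℕ → ℝ → ℂ)
    (hmono : StrictMono lam)
    (htop : Tendsto lam atTop atTop)
    (heig : ∀ n : ℕ, P.IsEigenpair (lam n) (φ n))
    (hrealφ : ∀ (n : ℕ) (z : ℝ), (φ n z).im = 0)
    (hall : ∀ μc : ℂ, P.IsEigenvalue μc → ∃ n : ℕ, μc = (lam n : ℂ))
    (horth : ∀ m n : ℕ, m ≠ n → P.inp (P.assoc (φ m)) (P.assoc (φ n)) = 0)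
    (hnorm : ∀ n : ℕ,
      P.inp (P.assoc (φ n)) (P.assoc (φ n)) = 1 ∨
      P.inp (P.assoc (φ n)) (P.assoc (φ n)) = -1)
    (i : Fin 2) (hi : P.inS i) :
    Tendsto
      (fun N : ℕ => ∫ z in P.z1..P.z2,
        Complex.normSq
          (((P.D i : ℂ))⁻¹ * ∑ n ∈ Finset.range N,
            (P.assoc (φ n) (P.zb i) / P.inp (P.assoc (φ n)) (P.assoc (φ n))) * φ n z) *
          P.r z)
      atTop (nhds 0) := by
  by_cases hD : P.D i = 0
  · simp [hD]
  have hε : ∀ n, ∃ ε : ℝ, (ε = 1 ∨ ε = -1) ∧ P.inp (P.assoc (φ n)) (P.assoc (φ n)) = ε := by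
    intro n
    rcases hnorm n with h | h
    · exact ⟨1, Or.inl rfl, by simp [h]⟩
    · exact ⟨-1, Or.inr rfl, by simp [h]⟩
  choose ε hε1 hε using hε
  have hred : ∀ n, P.reduce.IsEigenpair (lam n) (φ n) := fun n =>
    (heig n).reduce fun j hj => (heig n).Bop_eq_zero (heig (n + 1))
      (hmono.injective.ne n.succ_ne_self) (hrealφ (n + 1)) (horth (n + 1) n n.succ_ne_self) hD hj
  have key := SLP.tendsto_integral_normSq_null_series P.reduce
    (fun j hj => by
      rw [P.D_reduce] at hj
      exact ⟨if_pos hj, if_pos hj⟩)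
    hmono hred
    (fun μ ⟨ψ, hψ⟩ => hall μ ⟨ψ, hψ.of_reduce⟩) hε1
    (fun m n hmn => by rw [P.form_reduce, horth m n hmn])
    (fun n => by rw [P.form_reduce, hε n]) (i := i) (by rwa [P.D_reduce])
  refine key.congr fun N => intervalIntegral.integral_congr fun z _ => ?_
  refine congrArg₂ (· * ·) (congrArg _ ?_) rfl
  rw [Finset.mul_sum]
  refine Finset.sum_congr rfl fun n _ => ?_
  rw [P.D_reduce, P.Cop_reduce hD, P.conj_Cop (hrealφ n), P.assoc_zb hi, hε n]
  rcases hε1 n with h | h <;> rw [h] <;> push_cast <;> ring
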